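/- arXiv:1605.04449 — 2 statements merged into one kernel-verified Lean document; each statement's English description precedes it below -/
import Mathlib

section
/- For any λ ≥ 2, the random edge-indicator family (1_{e is open in O})_{e ∈ E_N} is stochastically dominated by (1_{e is open in L_{1/2,N}})_{e ∈ E_N}, where an edge e ∈ E_N is open in O iff η̃'_{N,v} > λ for all points v on the segment e(1), or η̃'_{N,v} < −λ for all points v on e(1), and an edge is open in L_{1/2,N} iff it is traversed by at least one loop of the critical random walk loop soup. -/
open MeasureTheory ProbabilityTheory Set

attribute [local instance] Classical.propDecidable

noncomputable section

/-! ### The lattice boxes `V_N`, adjacency, boundary -/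

/-- The `N × N` box `V_N ⊆ ℤ²`, centered at the origin or at `(1/2,1/2)` according to the
parity of `N`. -/
def box (N : ℕ) : Finset (ℤ × ℤ) :=
  Finset.Icc (-(((N : ℤ) - 1) / 2)) ((N : ℤ) / 2) ×ˢ
    Finset.Icc (-(((N : ℤ) - 1) / 2)) ((N : ℤ) / 2)

/-- `V_x = V_{⌊x⌋}` for real `x`. -/
def boxR (x : ℝ) : Finset (ℤ × ℤ) := box ⌊x⌋₊

/-- Nearest-neighbour adjacency on `ℤ²`. -/
def adj (u v : ℤ × ℤ) : Prop := |u.1 - v.1| + |u.2 - v.2| = 1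

/-- The four lattice neighbours of a point. -/
def nbrs (u : ℤ × ℤ) : Finset (ℤ × ℤ) :=
  {(u.1 + 1, u.2), (u.1 - 1, u.2), (u.1, u.2 + 1), (u.1, u.2 - 1)}

/-- The (inner) boundary `∂V_N`. -/
def bdry (N : ℕ) : Finset (ℤ × ℤ) :=
  (box N).filter fun v => ∃ u ∈ nbrs v, u ∉ box N

/-- `∂V_x = ∂V_{⌊x⌋}` for real `x`. -/
def bdryR (x : ℝ) : Finset (ℤ × ℤ) := bdry ⌊x⌋₊

/-! ### Simple random walk: killed transition kernel, Green's function, harmonic measure -/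

/-- `killedStep K n u v` is the probability that simple random walk started at `u` is at `v`
at time `n` without having visited the killing set `K` at any time `≤ n`. -/
def killedStep (K : Set (ℤ × ℤ)) : ℕ → (ℤ × ℤ) → (ℤ × ℤ) → ℝ
  | 0, u, v => if u = v ∧ u ∉ K then 1 else 0
  | n + 1, u, v => if u ∈ K then 0 else (1 / 4) * ∑ w ∈ nbrs u, killedStep K n w v

/-- Green's function of simple random walk killed on the set `K`: the expected number of
visits to `v` strictly before hitting `K`, for the walk started at `u`. -/
def greenK (K : Set (ℤ × ℤ)) (u v : ℤ × ℤ) : ℝ := ∑' n, killedStep K n u v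

/-- `G_{V_N}(u,v)`: Green's function of simple random walk killed at `∂V_N`. -/
def green (N : ℕ) (u v : ℤ × ℤ) : ℝ := greenK (↑(bdry N)) u v

/-- `hitStep A n v u` is the probability that simple random walk started at `v` first hits
the set `A` at time `n`, and does so at the point `u`. -/
def hitStep (A : Set (ℤ × ℤ)) : ℕ → (ℤ × ℤ) → (ℤ × ℤ) → ℝ
  | 0, v, u => if v = u ∧ v ∈ A then 1 else 0
  | n + 1, v, u => if v ∈ A then 0 else (1 / 4) * ∑ w ∈ nbrs v, hitStep A n w u

/-- Harmonic measure `Hm(v, u; A) = ℙ_v(S_{τ_A} = u)`. -/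
def hm (v u : ℤ × ℤ) (A : Set (ℤ × ℤ)) : ℝ := ∑' n, hitStep A n v u

/-- `Hm(v, B; A) = ∑_{u ∈ B} Hm(v, u; A)`. -/
def hmSet (v : ℤ × ℤ) (B A : Set (ℤ × ℤ)) : ℝ := ∑' u : B, hm v (↑u) A

/-! ### Centered Gaussian families and the discrete GFF -/

/-- `f` is a centered Gaussian family (over the indices in `S`) with covariance `K`:
every finite linear combination of the `f i`, `i ∈ S`, is a centered Gaussian variable whose
variance is the corresponding quadratic form of `K`. -/
def IsGaussFam {Ω ι : Type*} [MeasurableSpace Ω] (P : Measure Ω)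
    (f : ι → Ω → ℝ) (K : ι → ι → ℝ) (S : Set ι) : Prop :=
  (∀ i, Measurable (f i)) ∧
  ∀ l : ι →₀ ℝ, ↑l.support ⊆ S →
    P.map (fun ω => ∑ i ∈ l.support, l i * f i ω) =
      gaussianReal 0 (∑ i ∈ l.support, ∑ j ∈ l.support, l i * l j * K i j).toNNReal

/-- Covariance of the discrete GFF on `V_N` with Dirichlet boundary conditions:
`(1/4) G_{V_N}(u,v)`. -/
def gffCov (N : ℕ) (u v : ℤ × ℤ) : ℝ :=
  if u ∈ box N ∧ v ∈ box N then (1 / 4) * green N u v else 0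

/-- `η` is a discrete Gaussian free field on `V_N` with Dirichlet boundary conditions. -/
def IsGFF {Ω : Type*} [MeasurableSpace Ω] (N : ℕ) (P : Measure Ω)
    (η : ℤ × ℤ → Ω → ℝ) : Prop :=
  IsGaussFam P η (gffCov N) Set.univ

/-! ### Paths and chemical distances in lattice subgraphs -/

/-- `p` is a nearest-neighbour path of `n` steps from `u` to `v` staying in `H`. -/
def IsPath (H : Set (ℤ × ℤ)) (u v : ℤ × ℤ) (n : ℕ) (p : ℕ → ℤ × ℤ) : Prop :=
  p 0 = u ∧ p n = v ∧ (∀ i ≤ n, p i ∈ H) ∧ ∀ i < n, adj (p i) (p (i + 1))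

/-- The chemical distance (graph distance) between `A` and `B` inside `H` is `≤ t`. -/
def ConnLe (H : Set (ℤ × ℤ)) (A B : Set (ℤ × ℤ)) (t : ℝ) : Prop :=
  ∃ n : ℕ, (n : ℝ) ≤ t ∧ ∃ u ∈ A, ∃ v ∈ B, ∃ p, IsPath H u v n p

/-- The chemical distance (graph distance) between `A` and `B` inside `H` is `≥ t`
(in particular this holds when `A` and `B` are not connected inside `H`). -/
def DistGe (H : Set (ℤ × ℤ)) (A B : Set (ℤ × ℤ)) (t : ℝ) : Prop :=
  ∀ n : ℕ, ∀ u ∈ A, ∀ v ∈ B, ∀ p, IsPath H u v n p → t ≤ (n : ℝ)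

/-! ### The Gaussian free field on the metric graph `G̃'_N` of the doubled graph `G'_N`.

Each edge `e` of `V_N` is replaced by two parallel edges: `e(1)` of conductance `1/8`
(metric length 4) and `e(2)` of conductance `7/8` (metric length `4/7`).  A point on the
parallel copy `b ∈ {e(1), e(2)}` of the edge `(u,v)`, at metric distance `t` from `u`, is
recorded as `(u, v, b, t)`; the tag `b = true` denotes `e(1)`.  As in the paper, the field is
described by the discrete GFF at the vertices together with independent variance-2
Brownian-bridge fluctuations along each metric edge. -/

/-- Covariance of a variance-2 Brownian bridge of duration `T` (from `0` to `0`). -/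
def bridgeCov (T s t : ℝ) : ℝ := 2 * (min s t - s * t / T)

/-- Metric length of the two parallel edges: `e(1)` (tag `true`) has length 4 and `e(2)`
(tag `false`) has length `4/7`. -/
def edgeLen (b : Bool) : ℝ := if b then 4 else 4 / 7

/-- Index type for the joint family (vertex values ⊕ bridge fluctuations). -/
abbrev M2Idx : Type := (ℤ × ℤ) ⊕ ((ℤ × ℤ) × (ℤ × ℤ) × Bool × ℝ)

/-- Covariance of the joint family. -/
def m2Cov (N : ℕ) : M2Idx → M2Idx → ℝ
  | .inl u, .inl v => gffCov N u v
  | .inr ⟨u, v, b, s⟩, .inr ⟨u', v', b', t⟩ =>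
      if b = b' then
        (if u = u' ∧ v = v' then bridgeCov (edgeLen b) s t
         else if u = v' ∧ v = u' then bridgeCov (edgeLen b) s (edgeLen b - t)
         else 0)
      else 0
  | _, _ => 0

/-- The meaningful indices. -/
def m2Valid (N : ℕ) : Set M2Idx :=
  {i | match i with
       | .inl u => u ∈ box N
       | .inr ⟨u, v, b, t⟩ =>
           u ∈ box N ∧ v ∈ box N ∧ adj u v ∧ t ∈ Set.Icc (0 : ℝ) (edgeLen b)}

/-- The joint family of vertex values and bridge fluctuations. -/
def m2fam {Ω : Type*} (η : ℤ × ℤ → Ω → ℝ)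
    (brg : (ℤ × ℤ) → (ℤ × ℤ) → Bool → ℝ → Ω → ℝ) : M2Idx → Ω → ℝ
  | .inl u => η u
  | .inr ⟨u, v, b, t⟩ => brg u v b t

/-- The value `η̃'_{N,·}` of the metric-graph field at the point of the copy `b` of the edge
`(u,v)` at metric distance `t` from `u`. -/
def mval2 {Ω : Type*} (η : ℤ × ℤ → Ω → ℝ) (brg : (ℤ × ℤ) → (ℤ × ℤ) → Bool → ℝ → Ω → ℝ)
    (u v : ℤ × ℤ) (b : Bool) (t : ℝ) (ω : Ω) : ℝ :=
  (1 - t / edgeLen b) * η u ω + (t / edgeLen b) * η v ω + brg u v b t ω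

/-- `(η, brg)` is a Gaussian free field on the metric graph `G̃'_N`. -/
def IsMetricGFF2 {Ω : Type*} [MeasurableSpace Ω] (N : ℕ) (P : Measure Ω)
    (η : ℤ × ℤ → Ω → ℝ) (brg : (ℤ × ℤ) → (ℤ × ℤ) → Bool → ℝ → Ω → ℝ) : Prop :=
  IsGaussFam P (m2fam η brg) (m2Cov N) (m2Valid N) ∧
  (∀ u v b ω, brg u v b 0 ω = 0) ∧
  (∀ u v b ω, brg u v b (edgeLen b) ω = 0) ∧
  (∀ u v b t ω, brg u v b t ω = brg v u b (edgeLen b - t) ω) ∧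
  (∀ u v b ω, ContinuousOn (fun t => brg u v b t ω) (Set.Icc 0 (edgeLen b)))

/-! ### The random walk loop soup on `V_N`.

The loops of the continuous-time random walk loop soup on `V_N` (rate-1 nearest-neighbour
jumps, killed at `∂V_N`, with Le Jan's loop measure `μ`) traverse edges of `V_N` only through
their discrete skeletons.  Pushing the loop measure forward to discrete skeletons, the loops
with at least one jump form a countable family of based discrete loops
`(x₀, …, x_{n-1}, x₀)`, `n ≥ 2`, with all vertices in `V_N ∖ ∂V_N` and all steps between
neighbours, and the based loop `L` carries mass `μ(L) = (1/|L|) (1/4)^{|L|}`.  The loop soup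
of intensity `α` is then the Poisson point process on this countable set, i.e. a family of
independent Poisson counts `C L` with means `α μ(L)`, and an edge of `V_N` is open iff it is
traversed by some loop with `C L ≥ 1`. -/

/-- The vertices of `V_N` off the boundary. -/
def interiorBox (N : ℕ) : Finset (ℤ × ℤ) := box N \ bdry N

/-- Cyclic adjacency of the list of vertices of a based loop. -/
def cyclicAdj (L : List (ℤ × ℤ)) : Prop :=
  ∀ i : Fin L.length, adj (L.get i) (L.get ⟨(↑i + 1) % L.length, Nat.mod_lt _ i.pos⟩)

/-- `L` is (the skeleton of) a loop of the random walk loop soup on `V_N`: a based cycle of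
length at least 2 visiting only vertices of `V_N ∖ ∂V_N`. -/
def IsLoopIn (N : ℕ) (L : List (ℤ × ℤ)) : Prop :=
  2 ≤ L.length ∧ (∀ v ∈ L, v ∈ interiorBox N) ∧ cyclicAdj L

/-- The mass of a based discrete loop under the (skeleton of the) loop measure `μ`. -/
def loopMass (L : List (ℤ × ℤ)) : ℝ := (1 / L.length) * (1 / 4) ^ L.length

/-- The loop `L` makes a step from `u` to `v`. -/
def loopStep (L : List (ℤ × ℤ)) (u v : ℤ × ℤ) : Prop :=
  ∃ i : Fin L.length,
    L.get i = u ∧ L.get ⟨(↑i + 1) % L.length, Nat.mod_lt _ i.pos⟩ = v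

/-- `C` is a random walk loop soup with intensity `a` on `V_N`: independent Poisson counts,
`C L ~ Poisson(a μ(L))` for each loop `L`. -/
def IsLoopSoup {Ω : Type*} [MeasurableSpace Ω] (N : ℕ) (a : ℝ) (P : Measure Ω)
    (C : List (ℤ × ℤ) → Ω → ℕ) : Prop :=
  (∀ L, Measurable (C L)) ∧
  (∀ L, ¬IsLoopIn N L → ∀ ω, C L ω = 0) ∧
  (∀ L, IsLoopIn N L → ∀ k : ℕ,
    P {ω | C L ω = k} =
      ENNReal.ofReal (Real.exp (-(a * loopMass L)) * (a * loopMass L) ^ k / k.factorial)) ∧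
  iIndepFun (m := fun _ => (inferInstance : MeasurableSpace ℕ))
    (fun L : {L : List (ℤ × ℤ) // IsLoopIn N L} => C L.1) P

/-- The edge `{u,v}` is open: it is traversed by at least one loop of the soup. -/
def loopEdgeOpen {Ω : Type*} (N : ℕ) (C : List (ℤ × ℤ) → Ω → ℕ) (ω : Ω)
    (u v : ℤ × ℤ) : Prop :=
  ∃ L, IsLoopIn N L ∧ 0 < C L ω ∧ (loopStep L u v ∨ loopStep L v u)

/-- The chemical distance between `A` and `B` in the subgraph induced by the loop soup is
at most `t`. -/
def loopConnLe {Ω : Type*} (N : ℕ) (C : List (ℤ × ℤ) → Ω → ℕ) (A B : Set (ℤ × ℤ))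
    (t : ℝ) (ω : Ω) : Prop :=
  ∃ n : ℕ, (n : ℝ) ≤ t ∧ ∃ p : ℕ → ℤ × ℤ, p 0 ∈ A ∧ p n ∈ B ∧
    ∀ i < n, loopEdgeOpen N C ω (p i) (p (i + 1))

/-- The edge indicator family of `O`: the edge `{u,v}` is open iff `η̃'_N > λ` on all of the
copy `e(1)` of the edge, or `η̃'_N < -λ` on all of `e(1)`. -/
def oInd {Ω : Type*} (N : ℕ) (η : ℤ × ℤ → Ω → ℝ)
    (brg : (ℤ × ℤ) → (ℤ × ℤ) → Bool → ℝ → Ω → ℝ) (lam : ℝ) (ω : Ω) :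
    (ℤ × ℤ) × (ℤ × ℤ) → Bool := fun e =>
  if e.1 ∈ box N ∧ e.2 ∈ box N ∧ adj e.1 e.2 ∧
      ((∀ s ∈ Set.Icc (0 : ℝ) 4, lam < mval2 η brg e.1 e.2 true s ω) ∨
        ∀ s ∈ Set.Icc (0 : ℝ) 4, mval2 η brg e.1 e.2 true s ω < -lam)
    then true else false

/-- The edge indicator family of the loop soup: the edge `{u,v}` is open iff it is traversed
by at least one loop. -/
def lInd {Ω : Type*} (N : ℕ) (C : List (ℤ × ℤ) → Ω → ℕ) (ω : Ω) :
    (ℤ × ℤ) × (ℤ × ℤ) → Bool := fun e =>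
  if e.1 ∈ box N ∧ e.2 ∈ box N ∧ adj e.1 e.2 ∧ loopEdgeOpen N C ω e.1 e.2
    then true else false

set_option linter.unusedSectionVars false

namespace Aux
section B
variable {V E : Type} [Fintype V] [Fintype E]

def gw (x : V → ℝ) : ℝ := Real.exp (-2 * ∑ v, x v ^ 2)
def KK (s t : E → V) (e : E) (x : V → ℝ) : ℝ := x (s e) * x (t e)
def ZZ (s t : E → V) (B : Finset E) : ℝ := ∫ x : V → ℝ, gw x * Real.exp (∑ e ∈ B, KK s t e x)
def flip (σ : V → ℤˣ) (x : V → ℝ) : V → ℝ := fun v => ((σ v : ℤ) : ℝ) * x v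
def Zx (s t : E → V) (B : Finset E) (x : V → ℝ) : ℝ :=
  ∑ σ : V → ℤˣ, Real.exp (∑ e ∈ B, KK s t e (flip σ x))
def Tx (s t : E → V) (B : Finset E) (x : V → ℝ) : ℝ :=
  ∑ σ : V → ℤˣ, ∏ e ∈ B, Real.tanh (KK s t e (flip σ x))
def qq (s t : E → V) (e : E) (x : V → ℝ) : ℝ := 1 / Real.cosh (KK s t e x)

lemma flip_flip (σ τ : V → ℤˣ) (x : V → ℝ) : flip σ (flip τ x) = flip (σ * τ) x := by
  funext v; simp [flip, mul_assoc]

lemma sum_prod_ite (f g : E → ℝ) :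
    ∑ D : Finset E, ∏ e, (if e ∈ D then f e else g e) = ∏ e, (f e + g e) := by
  rw [Finset.prod_add, Finset.powerset_univ]
  refine Finset.sum_congr rfl fun D _ => ?_
  rw [Finset.prod_ite]
  congr 1
  · congr 1; ext; simp
  · congr 1; ext; simp

lemma Zx_flip (s t : E → V) (B : Finset E) (τ : V → ℤˣ) (x : V → ℝ) :
    Zx s t B (flip τ x) = Zx s t B x := by
  unfold Zx; simp only [flip_flip]
  exact Fintype.sum_equiv (Equiv.mulRight τ) _ _ (fun σ => rfl)

lemma Tx_flip (s t : E → V) (B : Finset E) (τ : V → ℤˣ) (x : V → ℝ) :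
    Tx s t B (flip τ x) = Tx s t B x := by
  unfold Tx; simp only [flip_flip]
  exact Fintype.sum_equiv (Equiv.mulRight τ) _ _ (fun σ => rfl)

lemma unit_cases (a : ℤˣ) : ((a : ℤ) : ℝ) = 1 ∨ ((a : ℤ) : ℝ) = -1 := by
  rcases Int.units_eq_one_or a with h | h <;> simp [h]

lemma exists_flip_nonneg (x : V → ℝ) : ∃ σ : V → ℤˣ, ∀ v, 0 ≤ flip σ x v := by
  refine ⟨fun v => if 0 ≤ x v then 1 else -1, fun v => ?_⟩
  by_cases h : 0 ≤ x v <;> simp only [flip, h, if_true, if_false]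
  · simpa using h
  · simp; linarith

lemma KK_flip (s t : E → V) (e : E) (σ : V → ℤˣ) (x : V → ℝ) :
    KK s t e (flip σ x) = (((σ (s e) * σ (t e) : ℤˣ) : ℤ) : ℝ) * KK s t e x := by
  simp [KK, flip]; ring

lemma tanh_flip (s t : E → V) (e : E) (σ : V → ℤˣ) (x : V → ℝ) :
    Real.tanh (KK s t e (flip σ x)) =
      (((σ (s e) * σ (t e) : ℤˣ) : ℤ) : ℝ) * Real.tanh (KK s t e x) := by
  rw [KK_flip]
  rcases unit_cases (σ (s e) * σ (t e)) with h | h <;> rw [h] <;> simp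

lemma qq_flip (s t : E → V) (e : E) (σ : V → ℤˣ) (x : V → ℝ) :
    qq s t e (flip σ x) = qq s t e x := by
  unfold qq
  rw [KK_flip]
  rcases unit_cases (σ (s e) * σ (t e)) with h | h <;> rw [h] <;> simp

lemma gw_flip (σ : V → ℤˣ) (x : V → ℝ) : gw (flip σ x) = gw x := by
  unfold gw
  congr 2
  refine Finset.sum_congr rfl fun v _ => ?_
  unfold flip
  rcases unit_cases (σ v) with h | h <;> rw [h] <;> ring

lemma Tx_nonneg (s t : E → V) (B : Finset E) (x : V → ℝ) : 0 ≤ Tx s t B x := by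
  obtain ⟨τ, hτ⟩ := exists_flip_nonneg x
  rw [← Tx_flip s t B τ]
  generalize flip τ x = y at hτ
  unfold Tx
  simp only [tanh_flip, Finset.prod_mul_distrib]
  rw [← Finset.sum_mul]
  refine mul_nonneg ?_ (Finset.prod_nonneg fun e _ => ?_)
  · set χ : (V → ℤˣ) → ℝ := fun σ => ∏ e ∈ B, (((σ (s e) * σ (t e) : ℤˣ) : ℤ) : ℝ) with hχ
    have hmul : ∀ σ τ, χ (σ * τ) = χ σ * χ τ := by
      intro σ τ
      simp only [hχ, ← Finset.prod_mul_distrib]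
      refine Finset.prod_congr rfl fun e _ => ?_
      simp; ring
    have hS : ∀ τ, (∑ σ, χ σ) * χ τ = ∑ σ, χ σ := by
      intro τ
      rw [Finset.sum_mul]
      simp only [← hmul]
      exact Fintype.sum_equiv (Equiv.mulRight τ) _ _ (fun σ => rfl)
    by_cases h : ∀ τ, χ τ = 1
    · exact Finset.sum_nonneg fun σ _ => by have := h σ; simp only [hχ] at this; rw [this]; norm_num
    · push Not at h
      obtain ⟨τ, h⟩ := h
      have h2 := hS τ
      have : (∑ σ, χ σ) = 0 := by
        by_contra h0
        exact h (mul_left_cancel₀ h0 (by rw [h2, mul_one]))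
      exact this.ge
  · have : 0 ≤ KK s t e y := mul_nonneg (hτ _) (hτ _)
    rw [Real.tanh_eq_sinh_div_cosh]
    exact div_nonneg (Real.sinh_nonneg_iff.2 this) (Real.cosh_pos _).le

lemma one_add_tanh (y : ℝ) : 1 + Real.tanh y = 1 / Real.cosh y * Real.exp y := by
  rw [Real.tanh_eq_sinh_div_cosh, ← Real.cosh_add_sinh y]
  have := (Real.cosh_pos y).ne'
  field_simp

lemma sum_Tx (s t : E → V) (B : Finset E) (x : V → ℝ) :
    ∑ B' ∈ B.powerset, Tx s t B' x = (∏ e ∈ B, qq s t e x) * Zx s t B x := by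
  unfold Tx Zx
  rw [Finset.sum_comm, Finset.mul_sum]
  refine Finset.sum_congr rfl fun σ _ => ?_
  rw [← Finset.prod_one_add]
  rw [Real.exp_sum, ← Finset.prod_mul_distrib]
  refine Finset.prod_congr rfl fun e _ => ?_
  rw [one_add_tanh, ← qq_flip s t e σ x, qq]

lemma Zx_pos (s t : E → V) (B : Finset E) (x : V → ℝ) : 0 < Zx s t B x :=
  Finset.sum_pos (fun _ _ => Real.exp_pos _) ⟨1, by simp⟩

lemma qq_pos (s t : E → V) (e : E) (x : V → ℝ) : 0 < qq s t e x :=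
  one_div_pos.2 (Real.cosh_pos _)

lemma qq_le (s t : E → V) (e : E) (x : V → ℝ) : qq s t e x ≤ 1 := by
  unfold qq; rw [div_le_one (Real.cosh_pos _)]; exact Real.one_le_cosh _

def rho (s t : E → V) (B : Finset E) (x : V → ℝ) : ℝ :=
  Tx s t B x / ((∏ e, qq s t e x) * Zx s t Finset.univ x)

lemma rho_den_pos (s t : E → V) (x : V → ℝ) :
    0 < (∏ e, qq s t e x) * Zx s t Finset.univ x :=
  mul_pos (Finset.prod_pos fun e _ => qq_pos s t e x) (Zx_pos _ _ _ _)

lemma rho_nonneg (s t : E → V) (B : Finset E) (x : V → ℝ) : 0 ≤ rho s t B x :=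
  div_nonneg (Tx_nonneg _ _ _ _) (rho_den_pos s t x).le

lemma sum_rho (s t : E → V) (x : V → ℝ) : ∑ B, rho s t B x = 1 := by
  unfold rho
  rw [← Finset.sum_div, ← Finset.powerset_univ, sum_Tx, div_self (rho_den_pos s t x).ne']

lemma rho_le (s t : E → V) (B : Finset E) (x : V → ℝ) : rho s t B x ≤ 1 := by
  rw [← sum_rho s t x]
  exact Finset.single_le_sum (f := fun B => rho s t B x) (fun B _ => rho_nonneg s t B x)
    (Finset.mem_univ B)

lemma sum_rho_sub (s t : E → V) (B : Finset E) (x : V → ℝ) :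
    (∏ e ∈ Bᶜ, qq s t e x) * ∑ B' ∈ B.powerset, rho s t B' x =
      Zx s t B x / Zx s t Finset.univ x := by
  unfold rho
  rw [← Finset.sum_div, sum_Tx, ← Finset.prod_mul_prod_compl B (fun e => qq s t e x)]
  have h1 : (∏ e ∈ B, qq s t e x) ≠ 0 := (Finset.prod_pos fun e _ => qq_pos s t e x).ne'
  have h2 : (∏ e ∈ Bᶜ, qq s t e x) ≠ 0 := (Finset.prod_pos fun e _ => qq_pos s t e x).ne'
  have h3 := (Zx_pos s t Finset.univ x).ne'
  field_simp

def kap (s t : E → V) (pO : E → (V → ℝ) → ℝ) (A D : Finset E) (x : V → ℝ) : ℝ :=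
  ∏ e, (if e ∈ D then (if e ∈ A then pO e x else 1 - qq s t e x - pO e x)
    else (if e ∈ A then 0 else qq s t e x))

def wO (pO : E → (V → ℝ) → ℝ) (A : Finset E) (x : V → ℝ) : ℝ :=
  ∏ e, (if e ∈ A then pO e x else 1 - pO e x)

lemma sum_kap_D (s t : E → V) (pO : E → (V → ℝ) → ℝ) (A : Finset E) (x : V → ℝ) :
    ∑ D, kap s t pO A D x = wO pO A x := by
  unfold kap wO
  rw [sum_prod_ite]
  refine Finset.prod_congr rfl fun e _ => ?_
  split_ifs <;> ring

lemma sum_kap_A (s t : E → V) (pO : E → (V → ℝ) → ℝ) (D : Finset E) (x : V → ℝ) :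
    ∑ A, kap s t pO A D x = ∏ e, (if e ∈ D then 1 - qq s t e x else qq s t e x) := by
  have : ∀ A, kap s t pO A D x = ∏ e, (if e ∈ A then (if e ∈ D then pO e x else 0)
      else (if e ∈ D then 1 - qq s t e x - pO e x else qq s t e x)) := by
    intro A
    refine Finset.prod_congr rfl fun e _ => ?_
    split_ifs <;> rfl
  simp only [this]
  rw [sum_prod_ite]
  refine Finset.prod_congr rfl fun e _ => ?_
  split_ifs <;> ring

lemma sum_ber_sub (q : E → ℝ) (B : Finset E) :
    ∑ D ∈ B.powerset, ∏ e, (if e ∈ D then 1 - q e else q e) = ∏ e ∈ Bᶜ, q e := by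
  have h1 : ∑ D ∈ B.powerset, ∏ e, (if e ∈ D then 1 - q e else q e) =
      ∑ D : Finset E, ∏ e, (if e ∈ D then (if e ∈ B then 1 - q e else 0) else q e) := by
    rw [← Finset.sum_subset (Finset.subset_univ B.powerset)]
    · refine Finset.sum_congr rfl fun D hD => Finset.prod_congr rfl fun e _ => ?_
      have := Finset.mem_powerset.1 hD
      split_ifs with h1 h2
      · rfl
      · exact absurd (this h1) h2
      · rfl
    · intro D _ hD
      rw [Finset.mem_powerset, Finset.not_subset] at hD
      obtain ⟨e, h1, h2⟩ := hD
      exact Finset.prod_eq_zero (Finset.mem_univ e) (by simp [h1, h2])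
  rw [h1, sum_prod_ite, ← Finset.prod_mul_prod_compl B]
  rw [Finset.prod_eq_one, one_mul]
  · refine Finset.prod_congr rfl fun e he => ?_
    rw [Finset.mem_compl] at he; simp [he]
  · intro e he; simp [he]

lemma measurePreserving_flip (σ : V → ℤˣ) :
    MeasurePreserving (flip σ) (volume : Measure (V → ℝ)) volume := by
  refine volume_preserving_pi (f := fun v y => ((σ v : ℤ) : ℝ) * y) fun v => ?_
  rcases unit_cases (σ v) with h | h <;> rw [h]
  · simp only [one_mul]; exact MeasurePreserving.id _
  · simpa using Measure.measurePreserving_neg (volume : Measure ℝ)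

lemma flip_emb (σ : V → ℤˣ) : MeasurableEmbedding (flip σ : (V → ℝ) → V → ℝ) := by
  have hinv : Function.LeftInverse (flip σ : (V → ℝ) → V → ℝ) (flip σ) := by
    intro x; funext v; simp only [flip]
    rcases unit_cases (σ v) with h | h <;> rw [h] <;> ring
  have hm : Measurable (flip σ : (V → ℝ) → V → ℝ) := by
    unfold flip; fun_prop
  exact MeasurableEquiv.measurableEmbedding ⟨⟨flip σ, flip σ, hinv, hinv⟩, hm, hm⟩

lemma integral_flip (σ : V → ℤˣ) (f : (V → ℝ) → ℝ) : ∫ x, f (flip σ x) = ∫ x, f x :=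
  (measurePreserving_flip σ).integral_comp (flip_emb σ) f

lemma meas_KK (s t : E → V) (e : E) : Measurable (KK s t e) := by unfold KK; fun_prop
lemma meas_gw : Measurable (gw : (V → ℝ) → ℝ) := by unfold gw; fun_prop
lemma meas_flip (σ : V → ℤˣ) : Measurable (flip σ : (V → ℝ) → V → ℝ) := (flip_emb σ).measurable
lemma meas_qq (s t : E → V) (e : E) : Measurable (qq s t e) := by
  unfold qq
  exact (Real.continuous_cosh.measurable.comp (meas_KK s t e)).const_div 1
lemma meas_Zx (s t : E → V) (B : Finset E) : Measurable (Zx s t B) := by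
  unfold Zx
  refine Finset.measurable_sum _ fun σ _ => Real.measurable_exp.comp ?_
  exact Finset.measurable_sum _ fun e _ => (meas_KK s t e).comp (meas_flip σ)
lemma meas_Tx (s t : E → V) (B : Finset E) : Measurable (Tx s t B) := by
  unfold Tx
  refine Finset.measurable_sum _ fun σ _ => ?_
  refine Finset.measurable_prod _ fun e _ => ?_
  have : Measurable Real.tanh := by
    have : Real.tanh = fun y => Real.sinh y / Real.cosh y := by
      funext y; exact Real.tanh_eq_sinh_div_cosh y
    rw [this]; fun_prop
  exact this.comp ((meas_KK s t e).comp (meas_flip σ))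
lemma meas_rho (s t : E → V) (B : Finset E) : Measurable (rho s t B) := by
  unfold rho
  exact (meas_Tx s t B).div ((Finset.measurable_prod _ fun e _ => meas_qq s t e).mul
    (meas_Zx s t _))
lemma meas_kap (s t : E → V) (pO : E → (V → ℝ) → ℝ) (hpm : ∀ e, Measurable (pO e))
    (A D : Finset E) : Measurable (kap s t pO A D) := by
  unfold kap
  refine Finset.measurable_prod _ fun e _ => ?_
  have := meas_qq s t e
  have := hpm e
  split_ifs <;> fun_prop

lemma moebius {f g : Finset E → ℝ}
    (h : ∀ B : Finset E, ∑ C ∈ B.powerset, f C = ∑ C ∈ B.powerset, g C) : f = g := by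
  funext B
  induction B using Finset.strongInduction with
  | H B ih =>
    have h1 := h B
    rw [← Finset.sum_erase_add _ f (Finset.mem_powerset_self B),
      ← Finset.sum_erase_add _ g (Finset.mem_powerset_self B)] at h1
    have h2 : ∑ C ∈ B.powerset.erase B, f C = ∑ C ∈ B.powerset.erase B, g C := by
      refine Finset.sum_congr rfl fun C hC => ih C ?_
      rw [Finset.mem_erase, Finset.mem_powerset] at hC
      exact Finset.ssubset_iff_subset_ne.2 ⟨hC.2, hC.1⟩
    linarith

theorem coupling (s t : E → V)
    (hint : ∀ B : Finset E, Integrable fun x : V → ℝ => gw x * Real.exp (∑ e ∈ B, KK s t e x))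
    (pO : E → (V → ℝ) → ℝ) (hpm : ∀ e, Measurable (pO e)) (hp0 : ∀ e x, 0 ≤ pO e x)
    (hp1 : ∀ e x, pO e x ≤ 1 - qq s t e x)
    (a l : Finset E → ℝ)
    (ha : ∀ A, a A = (ZZ s t Finset.univ)⁻¹ *
      ∫ x, gw x * Real.exp (∑ e, KK s t e x) * wO pO A x)
    (hl : ∀ B, ∑ C ∈ B.powerset, l C = (ZZ s t Finset.univ)⁻¹ * ZZ s t B) :
    ∃ c : Finset E → Finset E → ℝ, (∀ A B, 0 ≤ c A B) ∧ (∀ A B, c A B ≠ 0 → A ⊆ B) ∧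
      (∀ A, ∑ B, c A B = a A) ∧ (∀ B, ∑ A, c A B = l B) := by
  set w : (V → ℝ) → ℝ := fun x => gw x * Real.exp (∑ e, KK s t e x) with hw
  have hwpos : ∀ x, 0 < w x := fun x => mul_pos (Real.exp_pos _) (Real.exp_pos _)
  have hfac : ∀ (A D : Finset E) e x, 0 ≤ (if e ∈ D then (if e ∈ A then pO e x else 1 - qq s t e x - pO e x)
    else (if e ∈ A then 0 else qq s t e x)) ∧ (if e ∈ D then (if e ∈ A then pO e x else 1 - qq s t e x - pO e x)
    else (if e ∈ A then 0 else qq s t e x)) ≤ 1 := by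
    intro A D e x
    have := hp0 e x; have := hp1 e x; have := qq_pos s t e x; have := qq_le s t e x
    split_ifs <;> constructor <;> linarith
  have hkap0 : ∀ A D x, 0 ≤ kap s t pO A D x := fun A D x =>
    Finset.prod_nonneg fun e _ => (hfac A D e x).1
  have hkap1 : ∀ A D x, kap s t pO A D x ≤ 1 := fun A D x =>
    Finset.prod_le_one (fun e _ => (hfac A D e x).1) fun e _ => (hfac A D e x).2
  have hI : ∀ A D B', Integrable fun x => w x * (kap s t pO A D x * rho s t B' x) := by
    intro A D B'
    refine (hint Finset.univ).mul_bdd (c := 1)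
      ((meas_kap s t pO hpm A D).mul (meas_rho s t B')).aestronglyMeasurable ?_
    refine Filter.Eventually.of_forall fun x => ?_
    rw [Real.norm_of_nonneg (mul_nonneg (hkap0 _ _ _) (rho_nonneg _ _ _ _))]
    exact mul_le_one₀ (hkap1 _ _ _) (rho_nonneg _ _ _ _) (rho_le _ _ _ _)
  have hZ0 : 0 ≤ (ZZ s t Finset.univ)⁻¹ :=
    inv_nonneg.2 (integral_nonneg fun x => (hwpos x).le)
  set I : Finset E → Finset E → Finset E → ℝ := fun A D B' =>
    ∫ x, w x * (kap s t pO A D x * rho s t B' x) with hIdef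
  have hI0 : ∀ A D B', 0 ≤ I A D B' := fun A D B' => integral_nonneg fun x =>
    mul_nonneg (hwpos x).le (mul_nonneg (hkap0 _ _ _) (rho_nonneg _ _ _ _))
  have hIsub : ∀ A D B', ¬ A ⊆ D → I A D B' = 0 := by
    intro A D B' h
    rw [Finset.not_subset] at h
    obtain ⟨e, h1, h2⟩ := h
    have : ∀ x, kap s t pO A D x = 0 := fun x =>
      Finset.prod_eq_zero (Finset.mem_univ e) (by simp [h1, h2])
    simp [hIdef, this]
  refine ⟨fun A B => (ZZ s t Finset.univ)⁻¹ *
    ∑ D, ∑ B', if D ∪ B' = B then I A D B' else 0, ?_, ?_, ?_, ?_⟩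
  · intro A B
    refine mul_nonneg hZ0 (Finset.sum_nonneg fun D _ => Finset.sum_nonneg fun B' _ => ?_)
    split_ifs
    · exact hI0 _ _ _
    · exact le_rfl
  · intro A B h
    by_contra hAB
    apply h
    beta_reduce
    rw [Finset.sum_eq_zero, mul_zero]
    intro D _
    refine Finset.sum_eq_zero fun B' _ => ?_
    split_ifs with h1
    · apply hIsub
      intro hAD
      exact hAB (h1 ▸ hAD.trans Finset.subset_union_left)
    · rfl
  · intro A
    rw [ha, ← Finset.mul_sum]
    congr 1
    rw [Finset.sum_comm]
    have : ∀ x, gw x * Real.exp (∑ e, KK s t e x) * wO pO A x =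
        ∑ D, ∑ B', w x * (kap s t pO A D x * rho s t B' x) := by
      intro x
      simp only [← Finset.mul_sum, sum_rho, mul_one, sum_kap_D, hw]
    simp only [this]
    rw [integral_finsetSum _ fun D _ => integrable_finsetSum _ fun B' _ => hI A D B']
    refine Finset.sum_congr rfl fun D _ => ?_
    rw [integral_finsetSum _ fun B' _ => hI A D B', Finset.sum_comm]
    simp [hIdef]
  · apply congr_fun
    apply moebius
    intro B
    rw [hl]
    have e1 : ∑ C ∈ B.powerset, ∑ A, (ZZ s t Finset.univ)⁻¹ *
        (∑ D, ∑ B', if D ∪ B' = C then I A D B' else 0) =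
        (ZZ s t Finset.univ)⁻¹ * ∑ D ∈ B.powerset, ∑ B' ∈ B.powerset, ∑ A, I A D B' := by
      simp only [← Finset.mul_sum]
      congr 1
      rw [Finset.sum_comm]
      have : ∀ A, ∑ C ∈ B.powerset, (∑ D, ∑ B', if D ∪ B' = C then I A D B' else 0) =
          ∑ D ∈ B.powerset, ∑ B' ∈ B.powerset, I A D B' := by
        intro A
        rw [Finset.sum_comm]
        rw [← Finset.sum_subset (Finset.subset_univ B.powerset)]
        · refine Finset.sum_congr rfl fun D hD => ?_
          rw [Finset.sum_comm, ← Finset.sum_subset (Finset.subset_univ B.powerset)]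
          · refine Finset.sum_congr rfl fun B' hB' => ?_
            rw [Finset.sum_ite_eq, if_pos]
            rw [Finset.mem_powerset] at *
            exact Finset.union_subset hD hB'
          · intro B' _ hB'
            refine Finset.sum_eq_zero fun C hC => if_neg ?_
            rintro rfl
            rw [Finset.mem_powerset] at *
            exact hB' (Finset.subset_union_right.trans hC)
        · intro D _ hD
          refine Finset.sum_eq_zero fun C hC => Finset.sum_eq_zero fun B' _ => if_neg ?_
          rintro rfl
          rw [Finset.mem_powerset] at *
          exact hD (Finset.subset_union_left.trans hC)
      simp only [this]
      rw [Finset.sum_comm]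
      refine Finset.sum_congr rfl fun D _ => ?_
      rw [Finset.sum_comm]
    rw [e1]
    congr 1
    have e2 : ∑ D ∈ B.powerset, ∑ B' ∈ B.powerset, ∑ A, I A D B' =
        ∫ x, w x * (Zx s t B x / Zx s t Finset.univ x) := by
      have : ∀ x, w x * (Zx s t B x / Zx s t Finset.univ x) =
          ∑ D ∈ B.powerset, ∑ B' ∈ B.powerset, ∑ A, w x * (kap s t pO A D x * rho s t B' x) := by
        intro x
        rw [← sum_rho_sub, ← sum_ber_sub (fun e => qq s t e x) B]
        simp only [← Finset.mul_sum, ← Finset.sum_mul, sum_kap_A]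
      simp only [this]
      rw [integral_finsetSum _ fun D _ => integrable_finsetSum _ fun B' _ =>
        integrable_finsetSum _ fun A _ => hI A D B']
      refine Finset.sum_congr rfl fun D _ => ?_
      rw [integral_finsetSum _ fun B' _ =>
        integrable_finsetSum _ fun A _ => hI A D B']
      refine Finset.sum_congr rfl fun B' _ => ?_
      rw [integral_finsetSum _ fun A _ => hI A D B']
    rw [e2]
    -- symmetrization
    have hpoint : ∀ B x, ∑ σ : V → ℤˣ, gw (flip σ x) * Real.exp (∑ e ∈ B, KK s t e (flip σ x)) =
        gw x * Zx s t B x := by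
      intro B x
      simp only [gw_flip, ← Finset.mul_sum, Zx]
    have hintf : ∀ B (σ : V → ℤˣ), Integrable fun x : V → ℝ =>
        gw (flip σ x) * Real.exp (∑ e ∈ B, KK s t e (flip σ x)) := fun B σ =>
      ((measurePreserving_flip σ).integrable_comp_emb (flip_emb σ)).2 (hint B)
    set n : ℝ := (Fintype.card (V → ℤˣ) : ℝ)
    have hn : n ≠ 0 := by
      simp only [n]; exact_mod_cast Fintype.card_ne_zero
    have f1 : n * ZZ s t B = ∫ x : V → ℝ, gw x * Zx s t B x := by
      simp only [← hpoint]
      rw [integral_finsetSum _ fun σ _ => hintf B σ]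
      simp only [integral_flip _ (fun x => gw x * Real.exp (∑ e ∈ B, KK s t e x))]
      simp [n, ZZ]
    have hR : Integrable fun x => w x * (Zx s t B x / Zx s t Finset.univ x) := by
      refine (hint Finset.univ).mul_bdd (c := 1)
        ((meas_Zx s t B).div (meas_Zx s t _)).aestronglyMeasurable ?_
      refine Filter.Eventually.of_forall fun x => ?_
      rw [Real.norm_of_nonneg (div_pos (Zx_pos _ _ _ _) (Zx_pos _ _ _ _)).le, ← sum_rho_sub]
      refine mul_le_one₀ (Finset.prod_le_one (fun e _ => (qq_pos s t e x).le)
        fun e _ => qq_le s t e x) (Finset.sum_nonneg fun _ _ => rho_nonneg _ _ _ _) ?_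
      rw [← sum_rho s t x]
      exact Finset.sum_le_sum_of_subset_of_nonneg (Finset.subset_univ _)
        fun _ _ _ => rho_nonneg _ _ _ _
    have f2 : n * (∫ x, w x * (Zx s t B x / Zx s t Finset.univ x)) =
        ∫ x : V → ℝ, gw x * Zx s t B x := by
      have hpt : ∀ x, gw x * Zx s t B x =
          ∑ σ : V → ℤˣ, (fun x => w x * (Zx s t B x / Zx s t Finset.univ x)) (flip σ x) := by
        intro x
        have h1 := hpoint Finset.univ x
        simp only [Zx_flip, ← Finset.sum_mul, hw]
        rw [h1]
        have := (Zx_pos s t Finset.univ x).ne'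
        field_simp
      simp only [hpt]
      rw [integral_finsetSum]
      · simp only [integral_flip _ (fun x => w x * (Zx s t B x / Zx s t Finset.univ x))]
        simp [n]
      · intro σ _
        exact ((measurePreserving_flip σ).integrable_comp_emb (flip_emb σ)).2 hR
    exact mul_left_cancel₀ hn (f2.trans f1.symm)
end B
end Aux



namespace Aux
section A
variable {V E : Type} [Fintype V] [Fintype E]
open Matrix

def PB (s t : E → V) (B : Finset E) : Matrix V V ℝ :=
  (1 / 4 : ℝ) • ∑ e ∈ B, (Matrix.single (s e) (t e) 1 + Matrix.single (t e) (s e) 1)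

lemma PB_symm (s t : E → V) (B : Finset E) : (PB s t B).IsHermitian := by
  unfold PB
  rw [Matrix.IsHermitian, Matrix.conjTranspose_eq_transpose_of_trivial, Matrix.transpose_smul,
    Matrix.transpose_sum]
  congr 1
  refine Finset.sum_congr rfl fun e _ => ?_
  simp [add_comm]

lemma PB_quad (s t : E → V) (B : Finset E) (x : V → ℝ) :
    x ⬝ᵥ (PB s t B *ᵥ x) = (1 / 2) * ∑ e ∈ B, KK s t e x := by
  unfold PB KK
  rw [Matrix.smul_mulVec, dotProduct_smul, Matrix.sum_mulVec, dotProduct_sum, Finset.smul_sum,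
    Finset.mul_sum]
  refine Finset.sum_congr rfl fun e _ => ?_
  simp only [Matrix.add_mulVec, Matrix.single_mulVec, dotProduct_add]
  simp only [Function.update_apply,
    dotProduct, mul_ite, mul_zero, Pi.zero_apply, one_mul, Finset.sum_ite_eq', Finset.mem_univ,
    if_true, smul_eq_mul]
  ring

lemma spec (P : Matrix V V ℝ) (hP : P.IsHermitian) : ∃ (U : Matrix V V ℝ) (lam : V → ℝ),
    Uᵀ * U = 1 ∧ U * Uᵀ = 1 ∧ P = U * diagonal lam * Uᵀ := by
  refine ⟨hP.eigenvectorUnitary, hP.eigenvalues, ?_, ?_, ?_⟩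
  · have := Unitary.coe_star_mul_self hP.eigenvectorUnitary
    rwa [Matrix.star_eq_conjTranspose, Matrix.conjTranspose_eq_transpose_of_trivial] at this
  · apply mul_eq_one_comm.1
    have := Unitary.coe_star_mul_self hP.eigenvectorUnitary
    rwa [Matrix.star_eq_conjTranspose, Matrix.conjTranspose_eq_transpose_of_trivial] at this
  · have := hP.spectral_theorem
    rw [Unitary.conjStarAlgAut_apply, Matrix.star_eq_conjTranspose,
      Matrix.conjTranspose_eq_transpose_of_trivial] at this
    exact this

lemma spec_lt {P U : Matrix V V ℝ} {lam : V → ℝ} (hU : Uᵀ * U = 1)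
    (hP : P = U * diagonal lam * Uᵀ)
    (h : ∀ x : V → ℝ, x ≠ 0 → ∃ v, |(P *ᵥ x) v| < |x v|) (i : V) : |lam i| < 1 := by
  set x : V → ℝ := U *ᵥ Pi.single i 1 with hx
  have h1 : Uᵀ *ᵥ x = Pi.single i 1 := by
    rw [hx, Matrix.mulVec_mulVec, hU, Matrix.one_mulVec]
  have h0 : x ≠ 0 := by
    intro h0
    rw [h0, Matrix.mulVec_zero] at h1
    have := congr_fun h1 i
    simp at this
  have h2 : P *ᵥ x = lam i • x := by
    rw [hP, ← Matrix.mulVec_mulVec, h1, ← Matrix.mulVec_mulVec, Matrix.diagonal_mulVec_single, hx,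
      ← Matrix.mulVec_smul]
    congr 1
    rw [← Pi.single_smul, smul_eq_mul]
  obtain ⟨v, hv⟩ := h x h0
  rw [h2, Pi.smul_apply, smul_eq_mul, abs_mul] at hv
  have hxv : 0 < |x v| := by
    rcases (abs_nonneg (x v)).lt_or_eq with h | h
    · exact h
    · rw [← h] at hv; simp at hv
  exact lt_of_mul_lt_mul_right (by linarith) hxv.le

lemma spec_pow {P U : Matrix V V ℝ} {lam : V → ℝ} (hU : Uᵀ * U = 1)  (hU' : U * Uᵀ = 1)
    (hP : P = U * diagonal lam * Uᵀ) (n : ℕ) :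
    P ^ n = U * diagonal (fun i => lam i ^ n) * Uᵀ := by
  induction n with
  | zero => simp [hU']
  | succ n ih =>
    rw [pow_succ, ih, hP]
    calc _ = U * diagonal (fun i => lam i ^ n) * (Uᵀ * U) * diagonal lam * Uᵀ := by
          simp only [Matrix.mul_assoc]
      _ = _ := by
        rw [hU, Matrix.mul_one, Matrix.mul_assoc U, Matrix.diagonal_mul_diagonal]
        simp [pow_succ]

lemma spec_trace {P U : Matrix V V ℝ} {lam : V → ℝ} (hU : Uᵀ * U = 1)  (hU' : U * Uᵀ = 1)
    (hP : P = U * diagonal lam * Uᵀ) (n : ℕ) : (P ^ n).trace = ∑ i, lam i ^ n := by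
  rw [spec_pow hU hU' hP, Matrix.trace_mul_comm, ← Matrix.mul_assoc, hU, Matrix.one_mul,
    Matrix.trace_diagonal]

lemma spec_trace_hasSum {P U : Matrix V V ℝ} {lam : V → ℝ} (hU : Uᵀ * U = 1) (hU' : U * Uᵀ = 1)
    (hP : P = U * diagonal lam * Uᵀ) (hl : ∀ i, |lam i| < 1) :
    HasSum (fun n : ℕ => (P ^ (n + 1)).trace / (n + 1)) (-∑ i, Real.log (1 - lam i)) := by
  rw [← Finset.sum_neg_distrib]
  have := hasSum_sum fun (i : V) (_ : i ∈ Finset.univ) =>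
    Real.hasSum_pow_div_log_of_abs_lt_one (hl i)
  convert this using 2 with n
  rw [spec_trace hU hU' hP, Finset.sum_div]

lemma spec_green {P U : Matrix V V ℝ} {lam : V → ℝ} (hU : Uᵀ * U = 1) (hU' : U * Uᵀ = 1)
    (hP : P = U * diagonal lam * Uᵀ) (hl : ∀ i, |lam i| < 1) (u v : V) :
    HasSum (fun n : ℕ => (P ^ n) u v) (∑ i, U u i * (1 - lam i)⁻¹ * U v i) := by
  have := hasSum_sum fun (i : V) (_ : i ∈ Finset.univ) =>
    ((hasSum_geometric_of_abs_lt_one (hl i)).mul_left (U u i)).mul_right (U v i)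
  have h2 : (fun n : ℕ => (P ^ n) u v) = fun n => ∑ i, U u i * lam i ^ n * U v i := by
    funext n
    rw [spec_pow hU hU' hP, Matrix.mul_apply]
    simp [Matrix.mul_diagonal]
  rw [h2]
  exact this

lemma mp_U {U : Matrix V V ℝ} (hU : Uᵀ * U = 1) :
    MeasurePreserving (fun y : V → ℝ => U *ᵥ y) volume volume := by
  have hd : |U.det| = 1 := by
    have := congr_arg Matrix.det hU
    rw [Matrix.det_mul, Matrix.det_transpose, Matrix.det_one] at this
    rcases mul_self_eq_one_iff.1 this with h | h <;> simp [h]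
  have hd0 : U.det ≠ 0 := by intro h; simp [h] at hd
  refine ⟨by fun_prop, ?_⟩
  have := Real.map_matrix_volume_pi_eq_smul_volume_pi hd0
  rw [abs_inv, hd, inv_one, ENNReal.ofReal_one, one_smul] at this
  exact this

lemma emb_U {U : Matrix V V ℝ} (hU : Uᵀ * U = 1) (hU' : U * Uᵀ = 1) :
    MeasurableEmbedding (fun y : V → ℝ => U *ᵥ y) := by
  refine MeasurableEquiv.measurableEmbedding
    (⟨⟨fun y : V → ℝ => U *ᵥ y, fun y => Uᵀ *ᵥ y, fun y => ?_, fun y => ?_⟩, ?_, ?_⟩ :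
      (V → ℝ) ≃ᵐ (V → ℝ))
  · simp [Matrix.mulVec_mulVec, hU]
  · simp [Matrix.mulVec_mulVec, hU']
  · dsimp; fun_prop
  · dsimp; fun_prop

lemma w_eq (s t : E → V) (B : Finset E) {U : Matrix V V ℝ} {lam : V → ℝ} (hU : Uᵀ * U = 1)
    (hP : PB s t B = U * diagonal lam * Uᵀ) (y : V → ℝ) :
    gw (U *ᵥ y) * Real.exp (∑ e ∈ B, KK s t e (U *ᵥ y)) =
      ∏ i, Real.exp (-(2 * (1 - lam i)) * y i ^ 2) := by
  have h1 : ∑ e ∈ B, KK s t e (U *ᵥ y) = 2 * ∑ i, lam i * y i ^ 2 := by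
    have := PB_quad s t B (U *ᵥ y)
    have h2 : (U *ᵥ y) ⬝ᵥ (PB s t B *ᵥ (U *ᵥ y)) = ∑ i, lam i * y i ^ 2 := by
      rw [hP, Matrix.mulVec_mulVec, Matrix.mul_assoc, hU, Matrix.mul_one, ← Matrix.mulVec_mulVec,
        Matrix.dotProduct_mulVec, ← Matrix.mulVec_transpose, Matrix.mulVec_mulVec, hU,
        Matrix.one_mulVec]
      simp only [dotProduct, Matrix.mulVec_diagonal]
      refine Finset.sum_congr rfl fun i _ => by ring
    rw [h2] at this
    linarith
  have h3 : ∑ v, (U *ᵥ y) v ^ 2 = ∑ i, y i ^ 2 := by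
    have : (U *ᵥ y) ⬝ᵥ (U *ᵥ y) = y ⬝ᵥ y := by
      rw [Matrix.dotProduct_mulVec, ← Matrix.mulVec_transpose, Matrix.mulVec_mulVec, hU,
        Matrix.one_mulVec]
    simpa [dotProduct, pow_two] using this
  rw [gw, h1, h3, ← Real.exp_add, ← Real.exp_sum]
  congr 1
  rw [Finset.mul_sum, Finset.mul_sum, ← Finset.sum_add_distrib]
  refine Finset.sum_congr rfl fun i _ => by ring

lemma w_int (s t : E → V) (B : Finset E) {U : Matrix V V ℝ} {lam : V → ℝ} (hU : Uᵀ * U = 1)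
    (hU' : U * Uᵀ = 1) (hP : PB s t B = U * diagonal lam * Uᵀ) (hl : ∀ i, |lam i| < 1) :
    Integrable fun x : V → ℝ => gw x * Real.exp (∑ e ∈ B, KK s t e x) := by
  rw [← (mp_U hU).integrable_comp_emb (emb_U hU hU')]
  simp only [Function.comp_def, w_eq s t B hU hP]
  refine Integrable.fintype_prod (f := fun i y => Real.exp (-(2 * (1 - lam i)) * y ^ 2)) fun i => ?_
  exact integrable_exp_neg_mul_sq (by have := (abs_lt.1 (hl i)).2; linarith)

lemma ZZ_eq (s t : E → V) (B : Finset E) {U : Matrix V V ℝ} {lam : V → ℝ} (hU : Uᵀ * U = 1)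
    (hU' : U * Uᵀ = 1) (hP : PB s t B = U * diagonal lam * Uᵀ) (hl : ∀ i, |lam i| < 1) :
    ZZ s t B = √(Real.pi / 2) ^ Fintype.card V *
      Real.exp ((1 / 2) * (-∑ i, Real.log (1 - lam i))) := by
  unfold ZZ
  rw [← (mp_U hU).integral_comp (emb_U hU hU')]
  simp only [w_eq s t B hU hP]
  rw [integral_fintype_prod_volume_eq_prod (fun i y => Real.exp (-(2 * (1 - lam i)) * y ^ 2))]
  simp only [integral_gaussian]
  rw [← Finset.sum_neg_distrib, Finset.mul_sum, Real.exp_sum, ← Finset.card_univ,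
    ← Finset.prod_const, ← Finset.prod_mul_distrib]
  refine Finset.prod_congr rfl fun i _ => ?_
  have hpos : 0 < 1 - lam i := by have := (abs_lt.1 (hl i)).2; linarith
  rw [← div_div, Real.sqrt_div (by positivity)]
  rw [Real.sqrt_eq_rpow (1 - lam i), Real.rpow_def_of_pos hpos, div_eq_mul_inv, ← Real.exp_neg]
  congr 2; ring

lemma fourier_w (s t : E → V) (B : Finset E) {U : Matrix V V ℝ} {lam : V → ℝ} (hU : Uᵀ * U = 1)
    (hU' : U * Uᵀ = 1) (hP : PB s t B = U * diagonal lam * Uᵀ) (hl : ∀ i, |lam i| < 1)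
    (c : V → ℝ) :
    ∫ x : V → ℝ, Complex.exp (Complex.I * ((c ⬝ᵥ x : ℝ) : ℂ)) *
        ((gw x * Real.exp (∑ e ∈ B, KK s t e x) : ℝ) : ℂ) =
      (ZZ s t B : ℂ) * Complex.exp (((-(1 / 2) * ∑ i, (Uᵀ *ᵥ c) i ^ 2 * (1 / 4 * (1 - lam i)⁻¹)) : ℝ)) := by
  have key : ∀ c : V → ℝ, ∫ x : V → ℝ, Complex.exp (Complex.I * ((c ⬝ᵥ x : ℝ) : ℂ)) *
        ((gw x * Real.exp (∑ e ∈ B, KK s t e x) : ℝ) : ℂ) =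
      ∏ i, ((Real.pi / ((2 * (1 - lam i) : ℝ) : ℂ)) ^ (1 / 2 : ℂ) *
        Complex.exp (- (((Uᵀ *ᵥ c) i : ℝ) : ℂ) ^ 2 / (4 * ((2 * (1 - lam i) : ℝ) : ℂ)))) := by
    intro c
    rw [← (mp_U hU).integral_comp (emb_U hU hU')]
    simp only [w_eq s t B hU hP]
    have h1 : ∀ y : V → ℝ, Complex.exp (Complex.I * ((c ⬝ᵥ (U *ᵥ y) : ℝ) : ℂ)) *
        ((∏ i, Real.exp (-(2 * (1 - lam i)) * y i ^ 2) : ℝ) : ℂ) =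
        ∏ i, (Complex.exp (Complex.I * (((Uᵀ *ᵥ c) i : ℝ) : ℂ) * (y i : ℂ)) *
          Complex.exp (-((2 * (1 - lam i) : ℝ) : ℂ) * (y i : ℂ) ^ 2)) := by
      intro y
      rw [Finset.prod_mul_distrib, ← Complex.exp_sum]
      congr 1
      · rw [Matrix.dotProduct_mulVec, ← Matrix.mulVec_transpose]
        simp only [dotProduct]
        push_cast
        rw [Finset.mul_sum]
        congr 1
        refine Finset.sum_congr rfl fun i _ => by ring
      · push_cast; rfl
    simp only [h1]
    rw [integral_fintype_prod_volume_eq_prod (fun i (y : ℝ) =>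
      Complex.exp (Complex.I * (((Uᵀ *ᵥ c) i : ℝ) : ℂ) * (y : ℂ)) *
          Complex.exp (-((2 * (1 - lam i) : ℝ) : ℂ) * (y : ℂ) ^ 2))]
    refine Finset.prod_congr rfl fun i _ => ?_
    rw [fourierIntegral_gaussian]
    rw [Complex.ofReal_re]
    have := (abs_lt.1 (hl i)).2; linarith
  have h0 := key 0
  simp only [zero_dotProduct, Complex.ofReal_zero, mul_zero, Complex.exp_zero, one_mul,
    Matrix.mulVec_zero, Pi.zero_apply] at h0
  rw [integral_complex_ofReal] at h0
  change (ZZ s t B : ℂ) = _ at h0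
  rw [key c, h0, Finset.prod_mul_distrib, Finset.prod_mul_distrib]
  congr 1
  · simp
  · rw [← Complex.exp_sum]
    congr 1
    push_cast
    rw [Finset.mul_sum]
    refine Finset.sum_congr rfl fun i _ => ?_
    have hpos : 1 - lam i ≠ 0 := by have := (abs_lt.1 (hl i)).2; linarith
    have : (1 - (lam i : ℂ)) ≠ 0 := by exact_mod_cast hpos
    field_simp

lemma ZZ_pos (s t : E → V) (B : Finset E)
    (hint : Integrable fun x : V → ℝ => gw x * Real.exp (∑ e ∈ B, KK s t e x)) :
    0 < ZZ s t B := by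
  unfold ZZ
  rw [integral_pos_iff_support_of_nonneg
    (f := fun x : V → ℝ => gw x * Real.exp (∑ e ∈ B, KK s t e x)) (fun x => (mul_pos (Real.exp_pos _) (Real.exp_pos _)).le) hint]
  have : Function.support (fun x : V → ℝ => gw x * Real.exp (∑ e ∈ B, KK s t e x)) = univ := by
    ext x; simp [gw]
  rw [this]
  exact Measure.measure_univ_pos.2 (NeZero.ne _)

/-- the law of the Gaussian vector has the explicit density -/
theorem law_density (s t : E → V) (B : Finset E)
    (h : ∀ x : V → ℝ, x ≠ 0 → ∃ v, |(PB s t B *ᵥ x) v| < |x v|)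
    {Ω : Type} [MeasurableSpace Ω] (P : Measure Ω) [IsProbabilityMeasure P] (X : Ω → V → ℝ)
    (hX : Measurable X) (G : V → V → ℝ) (hG : ∀ u v, HasSum (fun n : ℕ => (PB s t B ^ n) u v) (G u v))
    (hgau : ∀ c : V → ℝ, P.map (fun ω => c ⬝ᵥ X ω) =
      gaussianReal 0 (∑ u, ∑ v, c u * c v * (1 / 4 * G u v)).toNNReal) :
    P.map X = volume.withDensity (fun x : V → ℝ => ENNReal.ofReal
      ((ZZ s t B)⁻¹ * (gw x * Real.exp (∑ e ∈ B, KK s t e x)))) := by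
  obtain ⟨U, lam, hU, hU', hP⟩ := spec _ (PB_symm s t B)
  have hl := spec_lt hU hP h
  have hint := w_int s t B hU hU' hP hl
  have hZ := ZZ_pos s t B hint
  have hGe : ∀ u v, G u v = ∑ i, U u i * (1 - lam i)⁻¹ * U v i := fun u v =>
    (hG u v).unique (spec_green hU hU' hP hl u v)
  have hvar : ∀ c : V → ℝ, ∑ u, ∑ v, c u * c v * (1 / 4 * G u v) =
      ∑ i, (Uᵀ *ᵥ c) i ^ 2 * (1 / 4 * (1 - lam i)⁻¹) := by
    intro c
    have e1 : ∀ i, (Uᵀ *ᵥ c) i ^ 2 * (1 / 4 * (1 - lam i)⁻¹) =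
        ∑ u, ∑ v, c u * c v * (1 / 4 * (U u i * (1 - lam i)⁻¹ * U v i)) := by
      intro i
      simp only [Matrix.mulVec, dotProduct, Matrix.transpose_apply, pow_two]
      rw [Finset.sum_mul_sum, Finset.sum_mul]
      refine Finset.sum_congr rfl fun u _ => ?_
      rw [Finset.sum_mul]
      refine Finset.sum_congr rfl fun v _ => by ring
    simp only [e1, hGe]
    conv_rhs => rw [Finset.sum_comm]
    refine Finset.sum_congr rfl fun u _ => ?_
    conv_rhs => rw [Finset.sum_comm]
    refine Finset.sum_congr rfl fun v _ => ?_
    rw [Finset.mul_sum, Finset.mul_sum]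
  have hint' : Integrable fun x : V → ℝ =>
      (ZZ s t B)⁻¹ * (gw x * Real.exp (∑ e ∈ B, KK s t e x)) := hint.const_mul _
  have hfin : IsFiniteMeasure (volume.withDensity (fun x : V → ℝ => ENNReal.ofReal
      ((ZZ s t B)⁻¹ * (gw x * Real.exp (∑ e ∈ B, KK s t e x))))) :=
    isFiniteMeasure_withDensity_ofReal hint'.2
  have : IsProbabilityMeasure (P.map X) := Measure.isProbabilityMeasure_map hX.aemeasurable
  apply Measure.ext_of_charFunDual
  funext L
  have hL : ∀ x : V → ℝ, L x = (fun v => L (Pi.single v 1)) ⬝ᵥ x := by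
    intro x
    conv_lhs => rw [pi_eq_sum_univ' x, map_sum]
    simp only [dotProduct]
    refine Finset.sum_congr rfl fun v _ => ?_
    rw [map_smul, smul_eq_mul, mul_comm]
  set c : V → ℝ := fun v => L (Pi.single v 1) with hc
  rw [charFunDual_apply, charFunDual_apply]
  simp only [hL]
  have lhs : ∫ x, Complex.exp (((c ⬝ᵥ x : ℝ) : ℂ) * Complex.I) ∂(P.map X) =
      Complex.exp (((-(1 / 2) * ∑ i, (Uᵀ *ᵥ c) i ^ 2 * (1 / 4 * (1 - lam i)⁻¹)) : ℝ)) := by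
    have h1 : charFun (P.map (fun ω => c ⬝ᵥ X ω)) 1 =
        ∫ x, Complex.exp (((c ⬝ᵥ x : ℝ) : ℂ) * Complex.I) ∂(P.map X) := by
      have hm : Measurable fun x : V → ℝ => c ⬝ᵥ x := by unfold dotProduct; fun_prop
      rw [charFun_apply_real, integral_map (φ := fun ω => c ⬝ᵥ X ω) (hm.comp hX).aemeasurable
        (Measurable.aestronglyMeasurable (by fun_prop)),
        integral_map hX.aemeasurable]
      · simp
      · refine Measurable.aestronglyMeasurable ?_
        fun_prop
    rw [← h1, hgau, charFun_gaussianReal, hvar]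
    congr 1
    rw [Real.coe_toNNReal]
    · push_cast; ring
    · refine Finset.sum_nonneg fun i _ => ?_
      have : 0 < 1 - lam i := by have := (abs_lt.1 (hl i)).2; linarith
      positivity
  rw [lhs]
  rw [integral_withDensity_eq_integral_toReal_smul]
  · have h2 := fourier_w s t B hU hU' hP hl c
    have h3 : ∀ x : V → ℝ, (ENNReal.ofReal
      ((ZZ s t B)⁻¹ * (gw x * Real.exp (∑ e ∈ B, KK s t e x)))).toReal •
        Complex.exp (((c ⬝ᵥ x : ℝ) : ℂ) * Complex.I) = ((ZZ s t B)⁻¹ : ℂ) *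
        (Complex.exp (Complex.I * ((c ⬝ᵥ x : ℝ) : ℂ)) *
        ((gw x * Real.exp (∑ e ∈ B, KK s t e x) : ℝ) : ℂ)) := by
      intro x
      rw [ENNReal.toReal_ofReal, Complex.real_smul]
      · push_cast
        rw [mul_comm Complex.I]; ring
      · exact mul_nonneg (inv_nonneg.2 hZ.le) (mul_pos (Real.exp_pos _) (Real.exp_pos _)).le
    simp only [h3]
    rw [integral_const_mul, h2, ← mul_assoc, inv_mul_cancel₀, one_mul]
    exact_mod_cast hZ.ne'
  · have := meas_gw (V := V)
    have hk : Measurable fun x : V → ℝ => ∑ e ∈ B, KK s t e x :=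
      Finset.measurable_sum _ fun e _ => meas_KK s t e
    fun_prop
  · exact Filter.Eventually.of_forall fun x => ENNReal.ofReal_lt_top
end A
end Aux



namespace Aux
section C
open Matrix

section walk
variable {V : Type} [Fintype V]

lemma pow_walk (P : Matrix V V ℝ) (n : ℕ) (u v : V) :
    (P ^ (n + 1)) u v = ∑ g : Fin n → V, ∏ i : Fin (n + 1),
      P (Fin.cons (α := fun _ => V) u g i) (Fin.snoc (α := fun _ => V) g v i) := by
  induction n generalizing u with
  | zero => simp [Fin.snoc]
  | succ n ih =>
    rw [pow_succ', Matrix.mul_apply]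
    rw [← (Fin.consEquiv (fun _ : Fin (n+1) => V)).sum_comp, Fintype.sum_prod_type]
    refine Finset.sum_congr rfl fun w _ => ?_
    rw [ih, Finset.mul_sum]
    refine Finset.sum_congr rfl fun g _ => ?_
    rw [Fin.prod_univ_succ (n := n + 1)]
    change _ = P (Fin.cons (α := fun _ => V) u (Fin.cons (α := fun _ => V) w g) 0)
      (Fin.snoc (α := fun _ => V) (Fin.cons (α := fun _ => V) w g) v 0) *
      ∏ i : Fin (n + 1), P (Fin.cons (α := fun _ => V) u (Fin.cons (α := fun _ => V) w g) i.succ)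
      (Fin.snoc (α := fun _ => V) (Fin.cons (α := fun _ => V) w g) v i.succ)
    rw [← Fin.cons_snoc_eq_snoc_cons]
    simp only [Fin.cons_zero, Fin.cons_succ]

lemma trace_walk (P : Matrix V V ℝ) (n : ℕ) :
    (P ^ (n + 1)).trace = ∑ f : Fin (n + 1) → V, ∏ i, P (f i) (f (i + 1)) := by
  rw [Matrix.trace, ← (Fin.consEquiv (fun _ : Fin (n+1) => V)).sum_comp, Fintype.sum_prod_type]
  refine Finset.sum_congr rfl fun u _ => ?_
  rw [Matrix.diag_apply, pow_walk]
  refine Finset.sum_congr rfl fun g _ => Finset.prod_congr rfl fun i _ => ?_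
  simp only [Fin.consEquiv_apply]
  congr 1
  refine Fin.lastCases ?_ (fun j => ?_) i
  · simp
  · simp [Fin.coeSucc_eq_succ]

end walk

def Vt (N : ℕ) : Type := {v : ℤ × ℤ // v ∈ interiorBox N}
instance (N : ℕ) : Fintype (Vt N) := inferInstanceAs (Fintype {v : ℤ × ℤ // v ∈ interiorBox N})

def ori (u v : ℤ × ℤ) : Prop := v = (u.1 + 1, u.2) ∨ v = (u.1, u.2 + 1)

def Et (N : ℕ) : Type := {e : Vt N × Vt N // ori e.1.1 e.2.1}
instance (N : ℕ) : Fintype (Et N) := Subtype.fintype (fun e : Vt N × Vt N => ori e.1.1 e.2.1)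

variable {N : ℕ}
def es (e : Et N) : Vt N := e.1.1
def et (e : Et N) : Vt N := e.1.2

lemma ori_adj {u v : ℤ × ℤ} (h : ori u v) : adj u v := by
  rcases h with h | h <;> simp [adj, h]

lemma adj_symm {u v : ℤ × ℤ} (h : adj u v) : adj v u := by
  unfold adj at *; rw [abs_sub_comm v.1, abs_sub_comm v.2]; exact h

lemma adj_iff {u v : ℤ × ℤ} : adj u v ↔ ori u v ∨ ori v u := by
  constructor
  · obtain ⟨a, b⟩ := u
    obtain ⟨c, d⟩ := v
    simp only [adj, ori, Prod.mk.injEq]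
    intro h
    rcases abs_cases (a - c) with h1 | h1 <;> rcases abs_cases (b - d) with h2 | h2 <;> omega
  · rintro (h | h)
    · exact ori_adj h
    · exact adj_symm (ori_adj h)

lemma ori_asymm {u v : ℤ × ℤ} (h : ori u v) : ¬ ori v u := by
  obtain ⟨a, b⟩ := u
  obtain ⟨c, d⟩ := v
  simp only [ori, Prod.mk.injEq] at *
  omega

/-- `{u,v}` is an edge in `B` -/
def inB (B : Finset (Et N)) (u v : ℤ × ℤ) : Prop :=
  ∃ e ∈ B, ((es e).1 = u ∧ (et e).1 = v) ∨ ((es e).1 = v ∧ (et e).1 = u)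

lemma Et_ext {e f : Et N} (h1 : (es e).1 = (es f).1) (h2 : (et e).1 = (et f).1) : e = f :=
  Subtype.ext (Prod.ext (Subtype.ext h1) (Subtype.ext h2))

lemma inB_adj {B : Finset (Et N)} {u v : ℤ × ℤ} (h : inB B u v) : adj u v := by
  obtain ⟨e, _, ⟨rfl, rfl⟩ | ⟨rfl, rfl⟩⟩ := h
  · exact ori_adj e.2
  · exact adj_symm (ori_adj e.2)

lemma inB_univ {u v : ℤ × ℤ} : inB (Finset.univ : Finset (Et N)) u v ↔
    u ∈ interiorBox N ∧ v ∈ interiorBox N ∧ adj u v := by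
  constructor
  · intro h
    refine ⟨?_, ?_, inB_adj h⟩
    · obtain ⟨e, _, ⟨rfl, rfl⟩ | ⟨rfl, rfl⟩⟩ := h
      · exact (es e).2
      · exact (et e).2
    · obtain ⟨e, _, ⟨rfl, rfl⟩ | ⟨rfl, rfl⟩⟩ := h
      · exact (et e).2
      · exact (es e).2
  · rintro ⟨hu, hv, h⟩
    rcases adj_iff.1 h with h | h
    · exact ⟨⟨(⟨u, hu⟩, ⟨v, hv⟩), h⟩, Finset.mem_univ _, Or.inl ⟨rfl, rfl⟩⟩
    · exact ⟨⟨(⟨v, hv⟩, ⟨u, hu⟩), h⟩, Finset.mem_univ _, Or.inr ⟨rfl, rfl⟩⟩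

lemma PB_entry (B : Finset (Et N)) (u v : Vt N) :
    PB es et B u v = if inB B u.1 v.1 then 1 / 4 else 0 := by
  unfold PB
  rw [Matrix.smul_apply, Matrix.sum_apply, smul_eq_mul]
  split_ifs with h
  · obtain ⟨e, he, h⟩ := h
    rw [Finset.sum_eq_single_of_mem e he]
    · rcases h with ⟨h1, h2⟩ | ⟨h1, h2⟩
      · have h1' : es e = u := Subtype.ext h1
        have h2' : et e = v := Subtype.ext h2
        have h3 : ¬ (v = u) := by
          rintro rfl
          have := e.2
          change ori (es e).1 (et e).1 at this
          rw [h1, h2] at this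
          exact ori_asymm this this
        simp [Matrix.single_apply, h1', h2', h3]
      · have h1' : es e = v := Subtype.ext h1
        have h2' : et e = u := Subtype.ext h2
        have h3 : ¬ (v = u) := by
          rintro rfl
          have := e.2
          change ori (es e).1 (et e).1 at this
          rw [h1, h2] at this
          exact ori_asymm this this
        simp [Matrix.single_apply, h1', h2', h3]
    · intro f hf hfe
      have hoe : ori (es e).1 (et e).1 := e.2
      have hof : ori (es f).1 (et f).1 := f.2
      have a1 : ¬ (es f = u ∧ et f = v) := by
        rintro ⟨rfl, rfl⟩
        rcases h with ⟨h1, h2⟩ | ⟨h1, h2⟩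
        · exact hfe (Et_ext h1.symm h2.symm)
        · rw [h1, h2] at hoe; exact ori_asymm hoe hof
      have a2 : ¬ (et f = u ∧ es f = v) := by
        rintro ⟨rfl, rfl⟩
        rcases h with ⟨h1, h2⟩ | ⟨h1, h2⟩
        · rw [h1, h2] at hoe; exact ori_asymm hoe hof
        · exact hfe (Et_ext h1.symm h2.symm)
      simp [Matrix.single_apply, a1, a2]
  · rw [Finset.sum_eq_zero, mul_zero]
    intro f hf
    have a1 : ¬ (es f = u ∧ et f = v) := by
      rintro ⟨rfl, rfl⟩
      exact h ⟨f, hf, Or.inl ⟨rfl, rfl⟩⟩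
    have a2 : ¬ (et f = u ∧ es f = v) := by
      rintro ⟨rfl, rfl⟩
      exact h ⟨f, hf, Or.inr ⟨rfl, rfl⟩⟩
    simp [Matrix.single_apply, a1, a2]

/-- PB as a sum over the four neighbours -/
lemma PB_mulVec (B : Finset (Et N)) (x : Vt N → ℝ) (u : Vt N) :
    (PB es et B *ᵥ x) u = (1 / 4) * ∑ w ∈ nbrs u.1,
      (if h : w ∈ interiorBox N then (if inB B u.1 w then x ⟨w, h⟩ else 0) else 0) := by
  have h1 : (PB es et B *ᵥ x) u = (1 / 4) * ∑ v : Vt N, (if inB B u.1 v.1 then x v else 0) := by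
    rw [Matrix.mulVec, dotProduct, Finset.mul_sum]
    refine Finset.sum_congr rfl fun v _ => ?_
    rw [PB_entry]; split_ifs <;> simp
  rw [h1]
  congr 1
  have h2 : ∑ v : Vt N, (if inB B u.1 v.1 then x v else 0) = ∑ w ∈ interiorBox N,
      (if h : w ∈ interiorBox N then (if inB B u.1 w then x ⟨w, h⟩ else 0) else 0) := by
    rw [← Finset.sum_attach (interiorBox N)]
    change _ = ∑ v ∈ (Finset.univ : Finset {v : ℤ × ℤ // v ∈ interiorBox N}), _
    refine Finset.sum_congr rfl fun v _ => ?_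
    rw [dif_pos v.2]; rfl
  rw [h2]
  have hnb : ∀ w, inB B u.1 w → w ∈ nbrs u.1 := by
    intro w hw
    rcases adj_iff.1 (inB_adj hw) with (h | h) | (h | h)
    · simp [nbrs, h]
    · simp [nbrs, h]
    · simp [nbrs, h]
    · simp [nbrs, h]
  rw [← Finset.sum_filter_add_sum_filter_not (interiorBox N) (fun w => w ∈ nbrs u.1),
    ← Finset.sum_filter_add_sum_filter_not (nbrs u.1) (fun w => w ∈ interiorBox N)]
  congr 1
  · congr 1; ext w; simp [and_comm]
  · rw [Finset.sum_eq_zero, Finset.sum_eq_zero]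
    · intro w hw; rw [Finset.mem_filter] at hw; simp [hw.2]
    · intro w hw; rw [Finset.mem_filter] at hw
      have : ¬ inB B u.1 w := fun h => hw.2 (hnb _ h)
      simp [this]

lemma nbrs_card (u : ℤ × ℤ) : (nbrs u).card = 4 := by
  obtain ⟨a, b⟩ := u
  unfold nbrs
  rw [Finset.card_insert_of_notMem, Finset.card_insert_of_notMem, Finset.card_insert_of_notMem,
    Finset.card_singleton] <;> simp <;> omega

lemma PB_strict (B : Finset (Et N)) (x : Vt N → ℝ) (hx : x ≠ 0) :
    ∃ v, |(PB es et B *ᵥ x) v| < |x v| := by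
  have hne : (Finset.univ : Finset (Vt N)).Nonempty := by
    obtain ⟨v, _⟩ := Function.ne_iff.1 hx
    exact ⟨v, Finset.mem_univ _⟩
  obtain ⟨m, _, hm⟩ := Finset.exists_max_image Finset.univ (fun v => |x v|) hne
  obtain ⟨v, hv, hmax⟩ := Finset.exists_max_image
    (Finset.univ.filter fun v => |x v| = |x m|) (fun v : Vt N => v.1.1) ⟨m, by simp⟩
  simp only [Finset.mem_filter, Finset.mem_univ, true_and] at hv hmax hm
  have hM : 0 < |x m| := by
    obtain ⟨w, hw⟩ := Function.ne_iff.1 hx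
    exact lt_of_lt_of_le (abs_pos.2 hw) (hm w trivial)
  refine ⟨v, ?_⟩
  rw [PB_mulVec, abs_mul, abs_of_pos (by norm_num : (0:ℝ) < 1/4), hv]
  set f : ℤ × ℤ → ℝ := fun w =>
    (if h : w ∈ interiorBox N then (if inB B v.1 w then x ⟨w, h⟩ else 0) else 0) with hf
  have hle : ∀ w, |f w| ≤ |x m| := by
    intro w
    simp only [hf]
    split_ifs
    · exact hm _ trivial
    · simp
    · simp
  have hlt : |f (v.1.1 + 1, v.1.2)| < |x m| := by
    simp only [hf]
    split_ifs with h1 h2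
    · refine lt_of_le_of_ne (hm _ trivial) fun he => ?_
      have := hmax ⟨_, h1⟩ he
      simp at this
    · simpa using hM
    · simpa using hM
  have : ∑ w ∈ nbrs v.1, |f w| < ∑ w ∈ nbrs v.1, |x m| :=
    Finset.sum_lt_sum (fun w _ => hle w) ⟨_, by simp [nbrs], hlt⟩
  rw [Finset.sum_const, nbrs_card] at this
  have h2 := Finset.abs_sum_le_sum_abs f (nbrs v.1)
  simp only [nsmul_eq_mul, Nat.cast_ofNat] at this
  linarith

/-! loops -/

lemma loopStep_ofFn {n : ℕ} (f : Fin (n + 1) → ℤ × ℤ) (u v : ℤ × ℤ) :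
    loopStep (List.ofFn f) u v ↔ ∃ i, f i = u ∧ f (i + 1) = v := by
  unfold loopStep
  have key : ∀ i : Fin (n + 1), (List.ofFn f).get ⟨i, by rw [List.length_ofFn]; exact i.2⟩ = f i := by
    intro i; simp only [List.get_eq_getElem, List.getElem_ofFn]
  have key2 : ∀ i : Fin (n + 1), ∀ h, (List.ofFn f).get ⟨(↑i + 1) % (List.ofFn f).length, h⟩ = f (i + 1) := by
    intro i h
    simp only [List.get_eq_getElem, List.getElem_ofFn]
    congr 1
    apply Fin.ext
    simp [Fin.val_add]
  constructor
  · rintro ⟨i, h1, h2⟩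
    have hi : i.1 < n + 1 := by simpa using i.2
    exact ⟨⟨i.1, hi⟩, by rw [← h1]; exact (key ⟨i.1, hi⟩).symm,
      by rw [← h2]; exact (key2 ⟨i.1, hi⟩ _).symm⟩
  · rintro ⟨i, h1, h2⟩
    exact ⟨⟨i, by rw [List.length_ofFn]; exact i.2⟩, by rw [← h1]; exact key i, by rw [← h2]; exact key2 i _⟩

lemma cyclicAdj_iff (L : List (ℤ × ℤ)) : cyclicAdj L ↔ ∀ u v, loopStep L u v → adj u v := by
  constructor
  · rintro h u v ⟨i, rfl, rfl⟩; exact h i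
  · intro h i; exact h _ _ ⟨i, rfl, rfl⟩

/-- loops using only edges of `B` -/
def okB (B : Finset (Et N)) (L : List (ℤ × ℤ)) : Prop :=
  IsLoopIn N L ∧ ∀ u v, loopStep L u v → inB B u v

lemma okB_univ (L : List (ℤ × ℤ)) : okB (Finset.univ : Finset (Et N)) L ↔ IsLoopIn N L := by
  refine ⟨fun h => h.1, fun h => ⟨h, fun u v hs => ?_⟩⟩
  rw [inB_univ]
  refine ⟨?_, ?_, (cyclicAdj_iff L).1 h.2.2 _ _ hs⟩
  · obtain ⟨i, rfl, rfl⟩ := hs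
    exact h.2.1 _ (List.get_mem _ _)
  · obtain ⟨i, rfl, rfl⟩ := hs
    exact h.2.1 _ (List.get_mem _ _)

def Wk (B : Finset (Et N)) (n : ℕ) : Type :=
  {f : Fin (n + 1) → Vt N // ∀ i, inB B (f i).1 (f (i + 1)).1}

instance (B : Finset (Et N)) (n : ℕ) : Fintype (Wk B n) :=
  Subtype.fintype (fun f : Fin (n + 1) → Vt N => ∀ i, inB B (f i).1 (f (i + 1)).1)

lemma trace_PB (B : Finset (Et N)) (n : ℕ) :
    (PB es et B ^ (n + 1)).trace = (1 / 4) ^ (n + 1) * (Fintype.card (Wk B n) : ℝ) := by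
  rw [trace_walk]
  have : ∀ f : Fin (n + 1) → Vt N, ∏ i, PB es et B (f i) (f (i + 1)) =
      if (∀ i, inB B (f i).1 (f (i + 1)).1) then (1 / 4 : ℝ) ^ (n + 1) else 0 := by
    intro f
    simp only [PB_entry]
    split_ifs with h
    · simp [h]
    · push Not at h
      obtain ⟨i, hi⟩ := h
      exact Finset.prod_eq_zero (Finset.mem_univ i) (by simp [hi])
  simp only [this]
  rw [← Finset.sum_filter, Finset.sum_const, nsmul_eq_mul, mul_comm]
  congr 2
  exact (Fintype.card_subtype _).symm

def toLoop (B : Finset (Et N)) (p : Σ n, Wk B n) : List (ℤ × ℤ) :=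
  List.ofFn fun i => (p.2.1 i).1

lemma toLoop_ok (B : Finset (Et N)) (p : Σ n, Wk B n) : okB B (toLoop B p) := by
  obtain ⟨n, f, hf⟩ := p
  have hs : ∀ u v, loopStep (toLoop B ⟨n, f, hf⟩) u v → inB B u v := by
    intro u v h
    obtain ⟨i, rfl, rfl⟩ := (loopStep_ofFn _ _ _).1 h
    exact hf i
  refine ⟨⟨?_, ?_, ?_⟩, hs⟩
  · rcases n with _ | n
    · exfalso
      have := hf 0
      have h2 := inB_adj this
      have h3 : (0 : Fin (0+1)) + 1 = 0 := rfl
      rw [h3] at h2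
      simp [adj] at h2
    · simp [toLoop]
  · intro v hv
    simp only [toLoop, List.mem_ofFn] at hv
    obtain ⟨i, rfl⟩ := hv
    exact (f i).2
  · rw [cyclicAdj_iff]
    exact fun u v h => inB_adj (hs u v h)

def loopEquiv (B : Finset (Et N)) : (Σ n, Wk B n) ≃ {L : List (ℤ × ℤ) // okB B L} := by
  refine Equiv.ofBijective (fun p => ⟨toLoop B p, toLoop_ok B p⟩) ⟨?_, ?_⟩
  · rintro ⟨n, f, hf⟩ ⟨m, g, hg⟩ h
    have h' : toLoop B ⟨n, f, hf⟩ = toLoop B ⟨m, g, hg⟩ := congr_arg Subtype.val h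
    have hl : n = m := by
      have := congr_arg List.length h'
      simpa [toLoop] using this
    subst hl
    have := List.ofFn_injective h'
    congr 2
    funext i
    exact Subtype.ext (congr_fun this i)
  · rintro ⟨L, hL⟩
    obtain ⟨n, hn⟩ : ∃ n, L.length = n + 1 := ⟨L.length - 1, by have := hL.1.1; omega⟩
    obtain ⟨f, rfl⟩ : ∃ f : Fin (n + 1) → ℤ × ℤ, L = List.ofFn f := by
      refine ⟨fun i => L.get (i.cast hn.symm), ?_⟩
      apply List.ext_get
      · simp [hn]
      · intro k h1 h2; simp only [List.get_eq_getElem, List.getElem_ofFn, Fin.val_cast]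
    refine ⟨⟨n, fun i => ⟨f i, hL.1.2.1 _ (List.mem_ofFn.2 ⟨i, rfl⟩)⟩, fun i => ?_⟩, ?_⟩
    · exact hL.2 _ _ ((loopStep_ofFn _ _ _).2 ⟨i, rfl, rfl⟩)
    · rfl

lemma loopMass_nonneg (L : List (ℤ × ℤ)) : 0 ≤ loopMass L := by unfold loopMass; positivity

theorem loops_ZZ (B : Finset (Et N)) : ∃ S : ℝ,
    HasSum (fun L : {L : List (ℤ × ℤ) // okB B L} => loopMass L.1) S ∧
    ZZ es et B = √(Real.pi / 2) ^ Fintype.card (Vt N) * Real.exp ((1 / 2) * S) := by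
  obtain ⟨U, lam, hU, hU', hP⟩ := spec _ (PB_symm es et B)
  have hl := spec_lt hU hP (PB_strict B)
  refine ⟨_, ?_, ZZ_eq es et B hU hU' hP hl⟩
  rw [← (loopEquiv B).hasSum_iff]
  have hm : ∀ p : Σ n, Wk B n, loopMass (toLoop B p) = (1 / (p.1 + 1 : ℝ)) * (1 / 4) ^ (p.1 + 1) := by
    intro p; simp [loopMass, toLoop]
  have hs := spec_trace_hasSum hU hU' hP hl
  have hin : ∀ n, HasSum (fun c : Wk B n => loopMass (toLoop B ⟨n, c⟩))
      ((PB es et B ^ (n + 1)).trace / (n + 1)) := by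
    intro n
    have := hasSum_fintype (fun c : Wk B n => loopMass (toLoop B ⟨n, c⟩))
    convert this using 1
    simp only [hm]
    rw [trace_PB, Finset.sum_const, nsmul_eq_mul, Finset.card_univ]
    ring
  refine HasSum.sigma_of_hasSum (f := fun p : Σ n, Wk B n => loopMass (toLoop B p)) hs hin ?_
  rw [summable_sigma_of_nonneg (fun p => loopMass_nonneg _)]
  refine ⟨fun n => (hin n).summable, ?_⟩
  simp only [fun n => (hin n).tsum_eq]
  exact hs.summable

lemma hint (B : Finset (Et N)) :
    Integrable fun x : Vt N → ℝ => gw x * Real.exp (∑ e ∈ B, KK es et e x) := by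
  obtain ⟨U, lam, hU, hU', hP⟩ := spec _ (PB_symm es et B)
  have hl := spec_lt hU hP (PB_strict B)
  exact w_int es et B hU hU' hP hl
end C
end Aux



namespace Aux
section D
variable {N : ℕ}

def oset {Ω : Type} (N : ℕ) (C : List (ℤ × ℤ) → Ω → ℕ) (ω : Ω) : Finset (Et N) :=
  Finset.univ.filter fun e => loopEdgeOpen N C ω (es e).1 (et e).1

lemma inB_self {B : Finset (Et N)} {e : Et N} (h : inB B (es e).1 (et e).1) : e ∈ B := by
  obtain ⟨f, hf, ⟨h1, h2⟩ | ⟨h1, h2⟩⟩ := h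
  · rwa [← Et_ext h1 h2]
  · exfalso
    have a : ori (es f).1 (et f).1 := f.2
    have b : ori (es e).1 (et e).1 := e.2
    rw [h1, h2] at a
    exact ori_asymm a b

lemma inB_comm {B : Finset (Et N)} {u v : ℤ × ℤ} (h : inB B u v) : inB B v u := by
  obtain ⟨f, hf, h⟩ := h
  exact ⟨f, hf, h.symm⟩

lemma oset_subset {Ω : Type} (C : List (ℤ × ℤ) → Ω → ℕ) (ω : Ω) (B : Finset (Et N)) :
    oset N C ω ⊆ B ↔ ∀ L : {L : List (ℤ × ℤ) // IsLoopIn N L}, ¬ okB B L.1 → C L.1 ω = 0 := by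
  constructor
  · rintro h ⟨L, hL⟩ hn
    by_contra hC
    apply hn
    refine ⟨hL, fun u v hs => ?_⟩
    have := ((okB_univ L).2 hL).2 u v hs
    obtain ⟨e, _, he⟩ := this
    refine ⟨e, h ?_, he⟩
    simp only [oset, Finset.mem_filter, Finset.mem_univ, true_and]
    refine ⟨L, hL, Nat.pos_of_ne_zero hC, ?_⟩
    rcases he with ⟨rfl, rfl⟩ | ⟨rfl, rfl⟩
    · exact Or.inl hs
    · exact Or.inr hs
  · intro h e he
    simp only [oset, Finset.mem_filter, Finset.mem_univ, true_and] at he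
    obtain ⟨L, hL, hpos, hs⟩ := he
    by_contra hne
    have hok : ¬ okB B L := by
      intro hok
      apply hne
      apply inB_self
      rcases hs with hs | hs
      · exact hok.2 _ _ hs
      · exact inB_comm (hok.2 _ _ hs)
    have := h ⟨L, hL⟩ hok
    simp only at this
    omega

lemma meas_oset_subset {Ω : Type} [MeasurableSpace Ω] (C : List (ℤ × ℤ) → Ω → ℕ)
    (hC : ∀ L, Measurable (C L)) (B : Finset (Et N)) : MeasurableSet {ω | oset N C ω ⊆ B} := by
  simp only [oset_subset]
  rw [ofPred_forall]
  refine MeasurableSet.iInter fun L => ?_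
  by_cases h : okB B L.1
  · simp [h]
  · simp only [h, not_false_eq_true, forall_true_left]
    exact hC L.1 (measurableSet_singleton 0)

lemma meas_oset {Ω : Type} [MeasurableSpace Ω] (C : List (ℤ × ℤ) → Ω → ℕ)
    (hC : ∀ L, Measurable (C L)) (e : Et N) : MeasurableSet {ω | e ∈ oset N C ω} := by
  have : {ω | e ∈ oset N C ω} = {ω | oset N C ω ⊆ Finset.univ.erase e}ᶜ := by
    ext ω
    simp only [mem_ofPred_eq, mem_compl_iff, Finset.subset_iff, Finset.mem_erase, Finset.mem_univ,
      and_true]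
    constructor
    · intro h h2; exact h2 h rfl
    · intro h; by_contra h3; apply h; rintro x hx rfl; exact h3 hx
  rw [this]
  exact (meas_oset_subset C hC _).compl

lemma meas_fin_eq {Ω E : Type} [Fintype E] [MeasurableSpace Ω] (f : Ω → Finset E)
    (h : ∀ e, MeasurableSet {ω | e ∈ f ω}) (D : Finset E) : MeasurableSet {ω | f ω = D} := by
  have : {ω | f ω = D} = ⋂ e, {ω | e ∈ f ω ↔ e ∈ D} := by
    ext ω; simp [Finset.ext_iff]
  rw [this]
  refine MeasurableSet.iInter fun e => ?_
  by_cases he : e ∈ D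
  · simpa [he] using h e
  · simp only [he, iff_false]; exact (h e).compl

theorem prob_subset {Ω : Type} [MeasurableSpace Ω] (P : Measure Ω) [IsProbabilityMeasure P]
    (C : List (ℤ × ℤ) → Ω → ℕ) (hs : IsLoopSoup N (1 / 2) P C) (B : Finset (Et N)) :
    P.real {ω | oset N C ω ⊆ B} = (ZZ (es (N := N)) et Finset.univ)⁻¹ * ZZ es et B := by
  obtain ⟨hmeas, -, hpois, hind⟩ := hs
  obtain ⟨SB, hSB, hZB⟩ := loops_ZZ B
  obtain ⟨SU, hSU, hZU⟩ := loops_ZZ (Finset.univ : Finset (Et N))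
  set Lp := {L : List (ℤ × ℤ) // IsLoopIn N L} with hLp
  -- total mass
  have hSU' : HasSum (fun L : Lp => loopMass L.1) SU := by
    have e : Lp ≃ {L : List (ℤ × ℤ) // okB (Finset.univ : Finset (Et N)) L} :=
      Equiv.subtypeEquivRight fun L => (okB_univ L).symm
    rw [← (Equiv.subtypeEquivRight fun L => (okB_univ (N := N) L)).hasSum_iff]
    exact hSU
  have hSB' : HasSum (fun L : Lp => if okB B L.1 then loopMass L.1 else 0) SB := by
    have h1 : HasSum (fun L => if okB B L then loopMass L else 0) SB := by
      have := (hasSum_subtype_iff_indicator (s := {L | okB B L}) (f := loopMass) (a := SB)).1 hSB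
      have h3 : (fun L => if okB B L then loopMass L else 0) = {L | okB B L}.indicator loopMass := by
        funext L
        by_cases h : okB B L <;> simp [Set.indicator, h]
      rw [h3]; exact this
    have h2 := (hasSum_subtype_iff_of_support_subset (s := {L : List (ℤ × ℤ) | IsLoopIn N L})
      (f := fun L => if okB B L then loopMass L else 0) (a := SB) ?_).2 h1
    · exact h2
    · intro L hL
      simp only [Function.mem_support, ne_eq, ite_eq_right_iff, Classical.not_imp] at hL
      exact hL.1.1
  have hW : HasSum (fun L : Lp => if okB B L.1 then 0 else loopMass L.1) (SU - SB) := by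
    have h3 : (fun L : Lp => if okB B L.1 then 0 else loopMass L.1) =
        fun L : Lp => loopMass L.1 - (if okB B L.1 then loopMass L.1 else 0) := by
      funext L
      split_ifs <;> simp
    rw [h3]
    exact hSU'.sub hSB'
  -- events
  set sv : Lp → Set ℕ := fun L => if okB B L.1 then univ else {0} with hsv
  have hev : ∀ L : Lp, P ((C L.1) ⁻¹' sv L) =
      ENNReal.ofReal (Real.exp (-(1 / 2 * (if okB B L.1 then 0 else loopMass L.1)))) := by
    intro L
    simp only [hsv]
    split_ifs with h
    · simp
    · have := hpois L.1 L.2 0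
      simp only [pow_zero, mul_one, Nat.factorial_zero, Nat.cast_one, div_one] at this
      exact this
  have hfin : ∀ S : Finset Lp, P (⋂ L ∈ S, (C L.1) ⁻¹' sv L) =
      ENNReal.ofReal (Real.exp (-(1 / 2 * ∑ L ∈ S, (if okB B L.1 then 0 else loopMass L.1)))) := by
    intro S
    rw [hind.measure_inter_preimage_eq_mul S (sets := sv) (fun i _ => by trivial)]
    simp only [hev]
    rw [← ENNReal.ofReal_prod_of_nonneg fun _ _ => (Real.exp_pos _).le, ← Real.exp_sum,
      Finset.mul_sum, Finset.sum_neg_distrib]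
  have hset : {ω | oset N C ω ⊆ B} = ⋂ S : Finset Lp, ⋂ L ∈ S, (C L.1) ⁻¹' sv L := by
    ext ω
    simp only [mem_ofPred_eq, oset_subset, mem_iInter, mem_preimage, hsv]
    constructor
    · intro h S L hL
      split_ifs with hok
      · trivial
      · exact h L hok
    · intro h L hok
      have := h {L} L (by simp)
      simpa [hok] using this
  have hcount : Countable Lp := inferInstance
  have lim1 := tendsto_measure_iInter_atTop (μ := P) (s := fun S : Finset Lp =>
      ⋂ L ∈ S, (C L.1) ⁻¹' sv L)
    (fun S => (Finset.measurableSet_biInter S fun L _ =>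
      hmeas L.1 (by trivial)).nullMeasurableSet)
    (fun S T hST => biInter_subset_biInter_left hST) ⟨∅, by simp⟩
  rw [← hset] at lim1
  have lim2 : Filter.Tendsto (fun S : Finset Lp => P (⋂ L ∈ S, (C L.1) ⁻¹' sv L)) Filter.atTop
      (nhds (ENNReal.ofReal (Real.exp (-(1 / 2 * (SU - SB)))))) := by
    simp only [hfin]
    refine (ENNReal.continuous_ofReal.tendsto _).comp ?_
    refine (Real.continuous_exp.tendsto _).comp ?_
    exact (hW.const_mul (1 / 2)).neg
  have h3 := tendsto_nhds_unique lim1 lim2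
  rw [Measure.real, h3, ENNReal.toReal_ofReal (Real.exp_pos _).le, hZB, hZU]
  have hpi : √(Real.pi / 2) ^ Fintype.card (Vt N) ≠ 0 := by positivity
  rw [mul_inv, ← Real.exp_neg]
  have : Real.exp (-(1 / 2 * (SU - SB))) = Real.exp (-(1 / 2 * SU)) * Real.exp (1 / 2 * SB) := by
    rw [← Real.exp_add]; congr 1; ring
  rw [this]
  field_simp

theorem sum_law {Ω : Type} [MeasurableSpace Ω] (P : Measure Ω) [IsProbabilityMeasure P]
    (C : List (ℤ × ℤ) → Ω → ℕ) (hs : IsLoopSoup N (1 / 2) P C) (B : Finset (Et N)) :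
    ∑ D ∈ B.powerset, P.real {ω | oset N C ω = D} = (ZZ (es (N := N)) et Finset.univ)⁻¹ * ZZ es et B := by
  rw [← prob_subset P C hs B, ← measureReal_biUnion_finset]
  · congr 1
    ext ω; simp
  · intro D _ D' _ hne
    refine Set.disjoint_left.2 fun ω h1 h2 => hne ?_
    exact h1.symm.trans h2
  · intro D _
    exact meas_fin_eq _ (meas_oset C hs.1) D
end D
end Aux



namespace Aux
section E1

lemma gauss_comb {Ω ι κ : Type} [MeasurableSpace Ω] {P : Measure Ω} {f : ι → Ω → ℝ}
    {K : ι → ι → ℝ} {S : Set ι} (h : IsGaussFam P f K S) (s : Finset κ) (φ : κ → ι)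
    (hφ : ∀ i, φ i ∈ S) (c : κ → ℝ) :
    P.map (fun ω => ∑ i ∈ s, c i * f (φ i) ω) =
      gaussianReal 0 (∑ i ∈ s, ∑ j ∈ s, c i * c j * K (φ i) (φ j)).toNNReal := by
  set l : ι →₀ ℝ := ∑ i ∈ s, Finsupp.single (φ i) (c i) with hl
  have key : ∀ g : ι → ℝ, ∑ i ∈ l.support, l i * g i = ∑ i ∈ s, c i * g (φ i) := by
    intro g
    have h1 : Finsupp.linearCombination ℝ g l = ∑ i ∈ l.support, l i * g i := by
      simp [Finsupp.linearCombination_apply, Finsupp.sum]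
    have h2 : Finsupp.linearCombination ℝ g l = ∑ i ∈ s, c i * g (φ i) := by
      rw [hl, map_sum]
      simp [Finsupp.linearCombination_single]
    rw [← h1, h2]
  have hsupp : (l.support : Set ι) ⊆ S := by
    intro i hi
    have := Finsupp.support_finsetSum hi
    rw [Finset.mem_biUnion] at this
    obtain ⟨j, _, hj⟩ := this
    have := Finsupp.support_single_subset hj
    rw [Finset.mem_singleton] at this
    rw [this]; exact hφ j
  have := h.2 l hsupp
  have e1 : (fun ω => ∑ i ∈ l.support, l i * f i ω) = fun ω => ∑ i ∈ s, c i * f (φ i) ω := by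
    funext ω; exact key fun i => f i ω
  have e2 : ∑ i ∈ l.support, ∑ j ∈ l.support, l i * l j * K i j =
      ∑ i ∈ s, ∑ j ∈ s, c i * c j * K (φ i) (φ j) := by
    simp only [mul_assoc, ← Finset.mul_sum]
    rw [key fun i => ∑ j ∈ l.support, l j * K i j]
    refine Finset.sum_congr rfl fun i _ => ?_
    rw [key fun j => K (φ i) j]
  rw [e1, e2] at this
  exact this

lemma gauss_one {Ω ι : Type} [MeasurableSpace Ω] {P : Measure Ω} {f : ι → Ω → ℝ}
    {K : ι → ι → ℝ} {S : Set ι} (h : IsGaussFam P f K S) (i : ι) (hi : i ∈ S) :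
    P.map (f i) = gaussianReal 0 (K i i).toNNReal := by
  have := gauss_comb h (Finset.univ : Finset Unit) (fun _ => i) (fun _ => hi) (fun _ => 1)
  simpa using this

lemma gauss_var {Ω ι : Type} [MeasurableSpace Ω] {P : Measure Ω} {f : ι → Ω → ℝ}
    {K : ι → ι → ℝ} {S : Set ι} (h : IsGaussFam P f K S) (i : ι) (hi : i ∈ S) :
    Var[f i; P] = ((K i i).toNNReal : ℝ) := by
  rw [← variance_id_map (h.1 i).aemeasurable, gauss_one h i hi, variance_id_gaussianReal]

lemma gauss_proc {Ω ι κ : Type} [MeasurableSpace Ω] {P : Measure Ω} {f : ι → Ω → ℝ}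
    {K : ι → ι → ℝ} {S : Set ι} (h : IsGaussFam P f K S) (φ : κ → ι) (hφ : ∀ i, φ i ∈ S) :
    IsGaussianProcess (fun i => f (φ i)) P := by
  refine ⟨fun I => ⟨?_⟩⟩
  have hm : Measurable fun ω => I.restrict fun i => f (φ i) ω :=
    measurable_pi_lambda _ fun i => h.1 _
  refine isGaussian_of_map_eq_gaussianReal fun L => ?_
  rw [Measure.map_map (by fun_prop) hm]
  have := gauss_comb h (Finset.univ : Finset I) (fun i => φ i.1) (fun i => hφ _)
      (fun i => L (Pi.single i 1))
  refine ⟨0, _, Eq.trans ?_ this⟩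
  congr 1
  funext ω
  simp only [Function.comp_apply]
  have hp := LinearMap.pi_apply_eq_sum_univ (L : (I → ℝ) →ₗ[ℝ] ℝ) (I.restrict fun i => f (φ i) ω)
  simp only [ContinuousLinearMap.coe_coe] at hp
  rw [hp]
  refine Finset.sum_congr rfl fun i _ => ?_
  rw [smul_eq_mul, mul_comm]
  congr 2
  funext j
  simp [Pi.single_apply, eq_comm]

lemma gauss_cov0 {Ω ι : Type} [MeasurableSpace Ω] {P : Measure Ω} {f : ι → Ω → ℝ}
    {K : ι → ι → ℝ} {S : Set ι} (h : IsGaussFam P f K S) (i j : ι) (hi : i ∈ S) (hj : j ∈ S)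
    (h1 : K i j = 0) (h2 : K j i = 0) (h3 : 0 ≤ K i i) (h4 : 0 ≤ K j j) :
    cov[f i, f j; P] = 0 := by
  have hp := gauss_proc h (κ := S) (fun i => i.1) (fun i => i.2)
  have hLi : MemLp (f i) 2 P := (hp.hasGaussianLaw_eval ⟨i, hi⟩).memLp_two
  have hLj : MemLp (f j) 2 P := (hp.hasGaussianLaw_eval ⟨j, hj⟩).memLp_two
  have hPr := hp.isProbabilityMeasure
  have hv := variance_add hLi hLj
  have hs : Var[f i + f j; P] = K i i + K j j := by
    have := gauss_comb h (Finset.univ : Finset Bool) (fun b => if b then i else j)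
      (fun b => by cases b <;> simp [hi, hj]) (fun _ => 1)
    have e : (fun ω => ∑ b : Bool, (1 : ℝ) * f (if b then i else j) ω) = f i + f j := by
      funext ω; simp
    rw [e] at this
    rw [← variance_id_map ((h.1 i).add (h.1 j)).aemeasurable, this, variance_id_gaussianReal]
    simp [h1, h2]
    linarith
  rw [hs, gauss_var h i hi, gauss_var h j hj, Real.coe_toNNReal _ h3, Real.coe_toNNReal _ h4] at hv
  linarith

lemma mix {V E Ω 𝓑 : Type} [Fintype V] [Fintype E] [MeasurableSpace Ω] [MeasurableSpace 𝓑]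
    (P : Measure Ω) [IsProbabilityMeasure P] (X : Ω → V → ℝ) (hX : Measurable X)
    (β : E → Ω → 𝓑) (hβ : ∀ e, Measurable (β e)) (hXβ : IndepFun X (fun ω e => β e ω) P)
    (hββ : iIndepFun β P) (F : E → Set ((V → ℝ) × 𝓑)) (hF : ∀ e, MeasurableSet (F e))
    (A : Finset E) :
    P.real {ω | ∀ e, (X ω, β e ω) ∈ F e ↔ e ∈ A} =
      ∫ x, wO (fun e x => (P.map (β e)).real {b | (x, b) ∈ F e}) A x ∂(P.map X) := by
  have hprob : ∀ e, IsProbabilityMeasure (P.map (β e)) := fun e =>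
    Measure.isProbabilityMeasure_map (hβ e).aemeasurable
  have hprobX : IsProbabilityMeasure (P.map X) := Measure.isProbabilityMeasure_map hX.aemeasurable
  have hb : Measurable fun ω e => β e ω := measurable_pi_lambda _ hβ
  have j1 := (indepFun_iff_map_prod_eq_prod_map_map hX.aemeasurable hb.aemeasurable).1 hXβ
  have j2 := (iIndepFun_iff_map_fun_eq_pi_map (fun e => (hβ e).aemeasurable)).1 hββ
  rw [j2] at j1
  set T : Set ((V → ℝ) × (E → 𝓑)) := {p | ∀ e, (p.1, p.2 e) ∈ F e ↔ e ∈ A} with hT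
  have hTm : MeasurableSet T := by
    have : T = ⋂ e, {p | (p.1, p.2 e) ∈ F e ↔ e ∈ A} := by ext; simp [hT]
    rw [this]
    refine MeasurableSet.iInter fun e => ?_
    have hm : MeasurableSet {p : (V → ℝ) × (E → 𝓑) | (p.1, p.2 e) ∈ F e} :=
      (by fun_prop : Measurable fun p : (V → ℝ) × (E → 𝓑) => (p.1, p.2 e)) (hF e)
    by_cases he : e ∈ A
    · simpa only [he, iff_true] using hm
    · simp only [he, iff_false]; exact hm.compl
  have hsec : ∀ x, (Measure.pi fun e => P.map (β e)) (Prod.mk x ⁻¹' T) =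
      ENNReal.ofReal (wO (fun e x => (P.map (β e)).real {b | (x, b) ∈ F e}) A x) := by
    intro x
    have : Prod.mk x ⁻¹' T = Set.pi univ fun e => if e ∈ A then {b | (x, b) ∈ F e} else {b | (x, b) ∈ F e}ᶜ := by
      ext b
      simp only [hT, mem_preimage, mem_ofPred_eq, mem_pi, mem_univ, forall_true_left]
      refine forall_congr' fun e => ?_
      by_cases he : e ∈ A <;> simp [he]
    rw [this, Measure.pi_pi, wO, ENNReal.ofReal_prod_of_nonneg]
    · refine Finset.prod_congr rfl fun e _ => ?_
      have hm : MeasurableSet {b | (x, b) ∈ F e} := measurable_prodMk_left (hF e)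
      split_ifs with he
      · rw [ofReal_measureReal]
      · rw [← probReal_compl_eq_one_sub hm, ofReal_measureReal]
    · intro e _
      split_ifs
      · exact measureReal_nonneg
      · exact sub_nonneg.2 measureReal_le_one
  have h1 : P {ω | ∀ e, (X ω, β e ω) ∈ F e ↔ e ∈ A} =
      ∫⁻ x, ENNReal.ofReal (wO (fun e x => (P.map (β e)).real {b | (x, b) ∈ F e}) A x) ∂(P.map X) := by
    have : {ω | ∀ e, (X ω, β e ω) ∈ F e ↔ e ∈ A} = (fun ω => (X ω, fun e => β e ω)) ⁻¹' T := rfl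
    rw [this, ← Measure.map_apply (hX.prodMk hb) hTm, j1, Measure.prod_apply hTm]
    simp only [hsec]
  rw [Measure.real, h1, integral_eq_lintegral_of_nonneg_ae]
  · refine Filter.Eventually.of_forall fun x => ?_
    refine Finset.prod_nonneg fun e _ => ?_
    split_ifs
    · exact measureReal_nonneg
    · exact sub_nonneg.2 measureReal_le_one
  · refine Measurable.aestronglyMeasurable ?_
    unfold wO
    refine Finset.measurable_prod _ fun e _ => ?_
    have hmm : Measurable fun x => (P.map (β e)).real {b | (x, b) ∈ F e} :=
      (measurable_measure_prodMk_left (hF e)).ennreal_toReal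
    split_ifs
    · exact hmm
    · exact hmm.const_sub _

/-! gaussian tail -/
lemma tail (v : NNReal) (hv : v ≠ 0) (m : ℝ) (hm : 0 ≤ m) :
    (√(2 * Real.pi))⁻¹ * Real.exp (-(m / √v + 1) ^ 2 / 2) ≤ (gaussianReal 0 v).real (Ici m) := by
  have hv0 : (0 : ℝ) < v := lt_of_le_of_ne v.2 (fun h => hv (by ext; exact h.symm))
  have hs0 : 0 < √(v : ℝ) := Real.sqrt_pos.2 hv0
  have hss : √(v : ℝ) * √(v : ℝ) = v := Real.mul_self_sqrt hv0.le
  set c := √(v : ℝ) with hc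
  have h1 : (gaussianReal 0 v).real (Icc m (m + c)) ≤ (gaussianReal 0 v).real (Ici m) :=
    measureReal_mono Icc_subset_Ici_self
  refine le_trans ?_ h1
  rw [Measure.real, gaussianReal_apply_eq_integral _ hv, ENNReal.toReal_ofReal
    (integral_nonneg fun x => gaussianPDFReal_nonneg _ _ _)]
  have h2 : ∫ x in Icc m (m + c), gaussianPDFReal 0 v (m + c) ≤
      ∫ x in Icc m (m + c), gaussianPDFReal 0 v x := by
    refine setIntegral_mono_on ?_ (integrable_gaussianPDFReal 0 v).integrableOn
      measurableSet_Icc ?_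
    · exact integrableOn_const (by simp)
    · intro x hx
      unfold gaussianPDFReal
      have : (x - 0) ^ 2 ≤ (m + c - 0) ^ 2 := by
        have := hx.1; have := hx.2
        apply pow_le_pow_left₀ <;> linarith
      gcongr
  refine le_trans (le_of_eq ?_) h2
  rw [setIntegral_const, Real.volume_real_Icc_of_le (by linarith), gaussianPDFReal, smul_eq_mul,
    Real.sqrt_mul (x := 2 * Real.pi) (by positivity), ← hc]
  have e1 : -(m + c - 0) ^ 2 / (2 * (v : ℝ)) = -(m / c + 1) ^ 2 / 2 := by
    rw [← hss]; field_simp; ring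
  rw [e1]
  field_simp
  ring

lemma tail_num (a b k X : ℝ) (ha : 0 < a) (hb : 0 < b) (hX : 0 ≤ X) (hXX : X ^ 2 = a * b / 2)
    (hk : (a + 2) * (b + 2) ≤ k) :
    1 / Real.cosh k ≤ (√(2 * Real.pi))⁻¹ * Real.exp (-(X + 1) ^ 2 / 2) := by
  have hab : 2 * X ≤ a + b := by
    apply abs_le_of_sq_le_sq' _ (by linarith) |>.2; nlinarith [sq_nonneg (a - b), sq_nonneg X]
  have hkk : 3 + (X + 1) ^ 2 / 2 ≤ k := by nlinarith [sq_nonneg X]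
  have h1 : Real.exp k / 2 ≤ Real.cosh k := by
    rw [Real.cosh_eq]; have := Real.exp_pos (-k); linarith
  have hpi : √(2 * Real.pi) ≤ 3 := by
    rw [Real.sqrt_le_left (by norm_num)]; have := Real.pi_lt_d2; nlinarith
  have hpi0 : 0 < √(2 * Real.pi) := by positivity
  have he : 6 ≤ Real.exp 3 := by
    have h := Real.add_one_le_exp (1 : ℝ)
    have : Real.exp 3 = Real.exp 1 * Real.exp 1 * Real.exp 1 := by
      rw [← Real.exp_add, ← Real.exp_add]; norm_num
    rw [this]; nlinarith [mul_self_nonneg (Real.exp 1 - 2)]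
  have h2 : Real.exp 3 * Real.exp ((X + 1) ^ 2 / 2) ≤ Real.exp k := by
    rw [← Real.exp_add]; exact Real.exp_le_exp.2 hkk
  have h3 : Real.exp (-(X + 1) ^ 2 / 2) = (Real.exp ((X + 1) ^ 2 / 2))⁻¹ := by
    rw [← Real.exp_neg]; congr 1; ring
  rw [h3, ← mul_inv, one_div]
  refine inv_anti₀ (by positivity) ?_
  have h4 := Real.exp_pos ((X + 1) ^ 2 / 2)
  nlinarith

/-! continuity -/
abbrev TT : Type := {q : ℚ // 0 ≤ (q : ℝ) ∧ (q : ℝ) ≤ 4}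

lemma cont_iff (g : ℝ → ℝ) (hg : ContinuousOn g (Icc 0 4)) (l : ℝ) :
    (∀ s ∈ Icc (0 : ℝ) 4, l < g s) ↔ ∃ n : ℕ, ∀ q : TT, l + 1 / ((n : ℝ) + 1) ≤ g (q.1 : ℝ) := by
  constructor
  · intro h
    obtain ⟨s, hs, hmin⟩ := isCompact_Icc.exists_isMinOn ⟨0, by simp⟩ hg
    obtain ⟨n, hn⟩ := exists_nat_one_div_lt (sub_pos.2 (h s hs))
    refine ⟨n, fun q => ?_⟩
    have : g s ≤ g q.1 := hmin ⟨q.2.1, q.2.2⟩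
    linarith
  · rintro ⟨n, hn⟩ s hs
    have hpos : (0 : ℝ) < 1 / ((n : ℝ) + 1) := by positivity
    by_contra hle
    push Not at hle
    have hlt : g s < l + 1 / ((n : ℝ) + 1) := by linarith
    obtain ⟨δ, hδ, hd⟩ := Metric.continuousOn_iff.1 hg s hs (l + 1 / ((n : ℝ) + 1) - g s) (by linarith)
    obtain ⟨q, hq1, hq2⟩ := exists_rat_btwn (show max 0 (s - δ) < min 4 (s + δ) by
      rw [max_lt_iff, lt_min_iff, lt_min_iff]
      obtain ⟨h1, h2⟩ := hs
      refine ⟨⟨by norm_num, by linarith⟩, by linarith, by linarith⟩)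
    rw [max_lt_iff] at hq1
    rw [lt_min_iff] at hq2
    have h3 := hd q ⟨hq1.1.le, hq2.1.le⟩ (by rw [Real.dist_eq, abs_lt]; constructor <;> linarith)
    have h4 := hn ⟨q, hq1.1.le, hq2.1.le⟩
    rw [Real.dist_eq, abs_lt] at h3
    simp only at h4
    linarith
end E1
end Aux



namespace Aux
section E2
open Matrix
variable {N : ℕ}

lemma adj_of_nbrs {u w : ℤ × ℤ} (h : w ∈ nbrs u) : adj u w := by
  simp only [nbrs, Finset.mem_insert, Finset.mem_singleton] at h
  unfold adj
  rcases h with rfl | rfl | rfl | rfl <;> simp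

lemma nbrs_of_adj {u w : ℤ × ℤ} (h : adj u w) : w ∈ nbrs u := by
  simp only [nbrs, Finset.mem_insert, Finset.mem_singleton]
  rcases adj_iff.1 h with (h | h) | (h | h)
  · simp [h]
  · simp [h]
  · simp [h]
  · simp [h]

lemma killed_bdry (n : ℕ) {u : ℤ × ℤ} (hu : u ∈ bdry N) (v : ℤ × ℤ) :
    killedStep (↑(bdry N)) n u v = 0 := by
  cases n <;> simp [killedStep, hu]

lemma killed_eq (n : ℕ) (u v : Vt N) :
    killedStep (↑(bdry N)) n u.1 v.1 = (PB (es (N := N)) et Finset.univ ^ n) u v := by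
  induction n generalizing u with
  | zero =>
    have h1 : u.1 ∉ bdry N := (Finset.mem_sdiff.1 u.2).2
    have h2 : u.1 = v.1 ↔ u = v := ⟨fun h => Subtype.ext h, fun h => h ▸ rfl⟩
    simp [killedStep, h1, Matrix.one_apply, h2]
  | succ n ih =>
    have h1 : u.1 ∉ bdry N := (Finset.mem_sdiff.1 u.2).2
    have h2 : (PB (es (N := N)) et Finset.univ ^ (n + 1)) u v =
      (PB (es (N := N)) et Finset.univ *ᵥ fun w => (PB (es (N := N)) et Finset.univ ^ n) w v) u := by
      rw [pow_succ', Matrix.mul_apply]; rfl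
    rw [h2, PB_mulVec, killedStep, if_neg (by simpa using h1)]
    congr 1
    refine Finset.sum_congr rfl fun w hw => ?_
    split_ifs with h3 h4
    · exact ih ⟨w, h3⟩
    · exact absurd (inB_univ.2 ⟨u.2, h3, adj_of_nbrs hw⟩) h4
    · have hb : w ∈ box N := by
        by_contra hb
        exact h1 (Finset.mem_filter.2 ⟨(Finset.mem_sdiff.1 u.2).1, w, hw, hb⟩)
      refine killed_bdry n ?_ _
      by_contra hb'
      exact h3 (Finset.mem_sdiff.2 ⟨hb, hb'⟩)

lemma green_hasSum (u v : Vt N) :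
    HasSum (fun n => (PB (es (N := N)) et Finset.univ ^ n) u v) (green N u.1 v.1) := by
  obtain ⟨U, lam, hU, hU', hP⟩ := spec (PB (es (N := N)) et Finset.univ) (PB_symm _ _ _)
  have hs := spec_green hU hU' hP (spec_lt hU hP (PB_strict _)) u v
  have : green N u.1 v.1 = ∑' n, (PB (es (N := N)) et Finset.univ ^ n) u v := by
    unfold green greenK
    exact tsum_congr fun n => killed_eq n u v
  rw [this]
  exact hs.summable.hasSum

lemma cov_int (u v : Vt N) : gffCov N u.1 v.1 = 1 / 4 * green N u.1 v.1 := by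
  unfold gffCov
  rw [if_pos ⟨(Finset.mem_sdiff.1 u.2).1, (Finset.mem_sdiff.1 v.2).1⟩]

lemma killed_nonneg (K : Set (ℤ × ℤ)) (n : ℕ) (u v : ℤ × ℤ) : 0 ≤ killedStep K n u v := by
  induction n generalizing u with
  | zero => simp only [killedStep]; split_ifs <;> norm_num
  | succ n ih =>
    simp only [killedStep]
    split_ifs
    · exact le_rfl
    · exact mul_nonneg (by norm_num) (Finset.sum_nonneg fun w _ => ih w)

lemma cov_nonneg (u v : ℤ × ℤ) : 0 ≤ gffCov N u v := by
  unfold gffCov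
  split_ifs
  · exact mul_nonneg (by norm_num) (tsum_nonneg fun n => killed_nonneg _ n u v)
  · exact le_rfl

lemma cov_bdry {u : ℤ × ℤ} (hu : u ∈ bdry N) (v : ℤ × ℤ) : gffCov N u v = 0 := by
  unfold gffCov green greenK
  simp [killed_bdry _ hu]

variable {Ω : Type} [MeasurableSpace Ω] (P : Measure Ω) [IsProbabilityMeasure P]
  {η : ℤ × ℤ → Ω → ℝ} {brg : (ℤ × ℤ) → (ℤ × ℤ) → Bool → ℝ → Ω → ℝ}

def XX (N : ℕ) (η : ℤ × ℤ → Ω → ℝ) (ω : Ω) : Vt N → ℝ := fun v => η v.1 ω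
def bb (N : ℕ) (brg : (ℤ × ℤ) → (ℤ × ℤ) → Bool → ℝ → Ω → ℝ) (e : Et N) (ω : Ω) : TT → ℝ :=
  fun q => brg (es e).1 (et e).1 true (q.1 : ℝ) ω

variable (h : IsMetricGFF2 N P η brg)
include h

lemma meas_η (u : ℤ × ℤ) : Measurable (η u) := h.1.1 (.inl u)
lemma meas_brg (u v : ℤ × ℤ) (b : Bool) (t : ℝ) : Measurable (brg u v b t) :=
  h.1.1 (.inr ⟨u, v, b, t⟩)
lemma meas_XX : Measurable (XX N η) := measurable_pi_lambda _ fun v => meas_η P h v.1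
lemma meas_bb (e : Et N) : Measurable (bb N brg e) :=
  measurable_pi_lambda _ fun _ => meas_brg P h _ _ _ _

lemma η_bdry {u : ℤ × ℤ} (hu : u ∈ bdry N) : ∀ᵐ ω ∂P, η u ω = 0 := by
  have hv : (Sum.inl u : M2Idx) ∈ m2Valid N := (Finset.mem_filter.1 hu).1
  have h1 := gauss_one h.1 (.inl u) hv
  have h2 : m2Cov N (.inl u) (.inl u) = 0 := cov_bdry hu u
  rw [h2, Real.toNNReal_zero, gaussianReal_zero_var] at h1
  have h3 : ∀ᵐ x ∂(P.map (m2fam η brg (.inl u))), x = 0 := by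
    rw [h1]; exact ae_dirac_iff (measurableSet_singleton _) |>.2 rfl
  exact ae_of_ae_map (meas_η P h u).aemeasurable h3

lemma law_XX : P.map (XX N η) = volume.withDensity (fun x => ENNReal.ofReal
    ((ZZ (es (N := N)) et Finset.univ)⁻¹ *
      (gw x * Real.exp (∑ e, KK (es (N := N)) et e x)))) := by
  refine law_density es et Finset.univ (PB_strict _) P _ (meas_XX P h)
    (fun u v => green N u.1 v.1) green_hasSum fun c => ?_
  have := gauss_comb h.1 (Finset.univ : Finset (Vt N)) (fun v => (.inl v.1 : M2Idx))
    (fun v => (Finset.mem_sdiff.1 v.2).1) c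
  have e1 : (fun ω => c ⬝ᵥ XX N η ω) = fun ω => ∑ i, c i * m2fam η brg (.inl i.1) ω := rfl
  rw [e1, this]
  have e2 : ∀ u v : Vt N, m2Cov N (.inl u.1) (.inl v.1) = 1 / 4 * green N u.1 v.1 :=
    fun u v => cov_int u v
  simp only [e2]

def bIdx (p : (_ : Et N) × TT) : M2Idx := .inr ⟨(es p.1).1, (et p.1).1, true, (p.2.1 : ℝ)⟩

omit h
lemma bIdx_valid (p : (_ : Et N) × TT) : bIdx p ∈ m2Valid N := by
  refine ⟨(Finset.mem_sdiff.1 (es p.1).2).1, (Finset.mem_sdiff.1 (et p.1).2).1,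
    ori_adj p.1.2, ?_⟩
  simpa [edgeLen] using p.2.2

lemma bIdx_diag (p : (_ : Et N) × TT) : 0 ≤ m2Cov N (bIdx p) (bIdx p) := by
  have h1 := p.2.2.1
  have h2 := p.2.2.2
  simp only [bIdx, m2Cov, if_true, and_self, bridgeCov, edgeLen, min_self]
  nlinarith

lemma bIdx_off (p q : (_ : Et N) × TT) (hpq : p.1 ≠ q.1) : m2Cov N (bIdx p) (bIdx q) = 0 := by
  simp only [bIdx, m2Cov, if_true]
  rw [if_neg, if_neg]
  · rintro ⟨h1, h2⟩
    have h3 : ori (es p.1).1 (et p.1).1 := p.1.2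
    have h4 : ori (es q.1).1 (et q.1).1 := q.1.2
    rw [h1, h2] at h3
    exact ori_asymm h3 h4
  · rintro ⟨h1, h2⟩
    exact hpq (Et_ext h1 h2)

include h
lemma indep_bb : iIndepFun (fun e => bb N brg e) P := by
  refine IsGaussianProcess.iIndepFun_of_covariance_eq_zero
    (X := fun (e : Et N) (q : TT) ω => brg (es e).1 (et e).1 true (q.1 : ℝ) ω)
    (gauss_proc h.1 bIdx bIdx_valid) (fun e q => (meas_brg P h _ _ _ _).aemeasurable) ?_
  intro e f hef q r
  exact gauss_cov0 h.1 (bIdx ⟨e, q⟩) (bIdx ⟨f, r⟩) (bIdx_valid _) (bIdx_valid _)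
    (bIdx_off _ _ hef) (bIdx_off _ _ hef.symm) (bIdx_diag _) (bIdx_diag _)

lemma indep_XX : IndepFun (XX N η) (fun ω e => bb N brg e ω) P := by
  have h1 := IsGaussianProcess.indepFun_of_covariance_eq_zero (P := P)
    (X := fun (v : Vt N) ω => η v.1 ω)
    (Y := fun (p : (_ : Et N) × TT) ω => brg (es p.1).1 (et p.1).1 true (p.2.1 : ℝ) ω) (by
      have := gauss_proc h.1 (Sum.elim (fun v : Vt N => (.inl v.1 : M2Idx)) bIdx) (by
        rintro (v | p)
        · exact (Finset.mem_sdiff.1 v.2).1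
        · exact bIdx_valid p)
      convert this using 1
      funext i
      rcases i with v | p <;> rfl)
    (fun v => (meas_η P h _).aemeasurable) (fun p => (meas_brg P h _ _ _ _).aemeasurable) (by
      intro v p
      exact gauss_cov0 h.1 (.inl v.1) (bIdx p) (Finset.mem_sdiff.1 v.2).1 (bIdx_valid _)
        rfl rfl (cov_nonneg _ _) (bIdx_diag _))
  exact h1.comp (φ := id) (ψ := fun (f : (_ : Et N) × TT → ℝ) e q => f ⟨e, q⟩) measurable_id
    (measurable_pi_lambda _ fun e => measurable_pi_lambda _ fun q => measurable_pi_apply _)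

end E2
end Aux



namespace Aux
section E3
variable {N : ℕ}

def FF (lam : ℝ) (e : Et N) : Set ((Vt N → ℝ) × (TT → ℝ)) :=
  {p | (∃ n : ℕ, ∀ q : TT, lam + 1 / ((n : ℝ) + 1) ≤
      (1 - (q.1 : ℝ) / 4) * p.1 (es e) + ((q.1 : ℝ) / 4) * p.1 (et e) + p.2 q) ∨
    (∃ n : ℕ, ∀ q : TT, lam + 1 / ((n : ℝ) + 1) ≤
      -((1 - (q.1 : ℝ) / 4) * p.1 (es e) + ((q.1 : ℝ) / 4) * p.1 (et e) + p.2 q))}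

lemma meas_FF (lam : ℝ) (e : Et N) : MeasurableSet (FF lam e) := by
  have : FF lam e = (⋃ n : ℕ, ⋂ q : TT, {p : (Vt N → ℝ) × (TT → ℝ) | lam + 1 / ((n : ℝ) + 1) ≤
      (1 - (q.1 : ℝ) / 4) * p.1 (es e) + ((q.1 : ℝ) / 4) * p.1 (et e) + p.2 q}) ∪
      (⋃ n : ℕ, ⋂ q : TT, {p : (Vt N → ℝ) × (TT → ℝ) | lam + 1 / ((n : ℝ) + 1) ≤
      -((1 - (q.1 : ℝ) / 4) * p.1 (es e) + ((q.1 : ℝ) / 4) * p.1 (et e) + p.2 q)}) := by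
    ext p; simp [FF]
  rw [this]
  refine MeasurableSet.union ?_ ?_
  · refine MeasurableSet.iUnion fun n => MeasurableSet.iInter fun q => ?_
    exact measurableSet_le (by fun_prop) (by fun_prop)
  · refine MeasurableSet.iUnion fun n => MeasurableSet.iInter fun q => ?_
    exact measurableSet_le (by fun_prop) (by fun_prop)

variable {Ω : Type} [MeasurableSpace Ω] (P : Measure Ω) [IsProbabilityMeasure P]
  {η : ℤ × ℤ → Ω → ℝ} {brg : (ℤ × ℤ) → (ℤ × ℤ) → Bool → ℝ → Ω → ℝ}

variable (h : IsMetricGFF2 N P η brg)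
include h

lemma FF_iff (lam : ℝ) (e : Et N) (x : Vt N → ℝ) (ω : Ω) : (x, bb N brg e ω) ∈ FF lam e ↔
    (∀ s ∈ Icc (0 : ℝ) 4, lam < (1 - s / 4) * x (es e) + (s / 4) * x (et e) +
      brg (es e).1 (et e).1 true s ω) ∨
    (∀ s ∈ Icc (0 : ℝ) 4, (1 - s / 4) * x (es e) + (s / 4) * x (et e) +
      brg (es e).1 (et e).1 true s ω < -lam) := by
  have hc : ContinuousOn (fun s => (1 - s / 4) * x (es e) + (s / 4) * x (et e) +
      brg (es e).1 (et e).1 true s ω) (Icc 0 4) := by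
    refine ContinuousOn.add (by fun_prop) ?_
    simpa [edgeLen] using h.2.2.2.2 (es e).1 (et e).1 true ω
  have h1 := cont_iff _ hc lam
  have h2 := cont_iff _ hc.neg lam
  have h3 : (∀ s ∈ Icc (0 : ℝ) 4, (1 - s / 4) * x (es e) + (s / 4) * x (et e) +
      brg (es e).1 (et e).1 true s ω < -lam) ↔ (∀ s ∈ Icc (0 : ℝ) 4, lam < -((1 - s / 4) * x (es e) + (s / 4) * x (et e) +
      brg (es e).1 (et e).1 true s ω)) := by
    refine forall₂_congr fun s _ => ?_
    exact lt_neg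
  rw [h3, h1]
  exact or_congr Iff.rfl h2.symm

lemma brg_tail (e : Et N) (a b k : ℝ) (ha : 0 < a) (hb : 0 < b) (hk : (a + 2) * (b + 2) ≤ k) :
    1 / Real.cosh k ≤ P.real {ω | 2 * a * b / (a + b) ≤
      brg (es e).1 (et e).1 true (4 * a / (a + b)) ω} ∧
    1 / Real.cosh k ≤ P.real {ω | brg (es e).1 (et e).1 true (4 * a / (a + b)) ω ≤
      -(2 * a * b / (a + b))} := by
  set t := 4 * a / (a + b) with ht
  set m := 2 * a * b / (a + b) with hm
  have hab : 0 < a + b := by positivity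
  have hm0 : 0 < m := by positivity
  have hvalid : (Sum.inr ⟨(es e).1, (et e).1, true, t⟩ : M2Idx) ∈ m2Valid N := by
    refine ⟨(Finset.mem_sdiff.1 (es e).2).1, (Finset.mem_sdiff.1 (et e).2).1, ori_adj e.2, ?_⟩
    simp only [edgeLen, if_true]
    refine ⟨by positivity, ?_⟩
    rw [ht, div_le_iff₀ hab]; linarith
  have hcov : m2Cov N (.inr ⟨(es e).1, (et e).1, true, t⟩) (.inr ⟨(es e).1, (et e).1, true, t⟩) =
      8 * a * b / (a + b) ^ 2 := by
    simp only [m2Cov, if_true, and_self, bridgeCov, edgeLen, min_self]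
    rw [ht]; field_simp; ring
  have hg := gauss_one h.1 _ hvalid
  rw [hcov] at hg
  change P.map (brg (es e).1 (et e).1 true t) = _ at hg
  have hv0 : 0 < 8 * a * b / (a + b) ^ 2 := by positivity
  set v := (8 * a * b / (a + b) ^ 2).toNNReal with hv
  have hvv : (v : ℝ) = 8 * a * b / (a + b) ^ 2 := Real.coe_toNNReal _ hv0.le
  have hvne : v ≠ 0 := by
    intro h0; rw [h0] at hvv; simp only [NNReal.coe_zero] at hvv; linarith
  have hbound : 1 / Real.cosh k ≤ (gaussianReal 0 v).real (Ici m) := by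
    refine le_trans (tail_num a b k (m / √v) ha hb (by positivity) ?_ hk) (tail v hvne m hm0.le)
    have hsq : √(v : ℝ) ^ 2 = v := Real.sq_sqrt (NNReal.coe_nonneg v)
    rw [div_pow, hsq, hvv, hm]
    field_simp
    ring
  have hmb := meas_brg P h (es e).1 (et e).1 true t
  constructor
  · have : P.real {ω | m ≤ brg (es e).1 (et e).1 true t ω} = (gaussianReal 0 v).real (Ici m) := by
      rw [← hg, map_measureReal_apply hmb measurableSet_Ici]; rfl
    rw [this]; exact hbound
  · have : P.real {ω | brg (es e).1 (et e).1 true t ω ≤ -m} = (gaussianReal 0 v).real (Ici m) := by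
      have h1 : (gaussianReal 0 v).map (fun x => -x) = gaussianReal 0 v := by
        rw [gaussianReal_map_neg, neg_zero]
      rw [← h1, map_measureReal_apply measurable_neg measurableSet_Ici, ← hg,
        map_measureReal_apply hmb (measurable_neg measurableSet_Ici)]
      congr 1
      ext ω
      simp
    rw [this]; exact hbound

def pOpen (P : Measure Ω) (brg : (ℤ × ℤ) → (ℤ × ℤ) → Bool → ℝ → Ω → ℝ) (lam : ℝ) (e : Et N)
    (x : Vt N → ℝ) : ℝ := (P.map (bb N brg e)).real {b | (x, b) ∈ FF lam e}

lemma pOpen_le (lam : ℝ) (hlam : 2 ≤ lam) (e : Et N) (x : Vt N → ℝ) :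
    pOpen P brg lam e x ≤ 1 - qq es et e x := by
  have e1 : pOpen P brg lam e x = P.real {ω | (x, bb N brg e ω) ∈ FF lam e} := by
    unfold pOpen
    have hms : MeasurableSet {b | (x, b) ∈ FF lam e} := measurable_prodMk_left (meas_FF lam e)
    rw [map_measureReal_apply (meas_bb P h e) hms]; rfl
  rw [e1]
  have hb0 : ∀ ω, brg (es e).1 (et e).1 true 0 ω = 0 := h.2.1 _ _ _
  have hb4 : ∀ ω, brg (es e).1 (et e).1 true 4 ω = 0 := by
    intro ω; simpa [edgeLen] using h.2.2.1 (es e).1 (et e).1 true ω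
  have hq : qq es et e x = 1 / Real.cosh (x (es e) * x (et e)) := rfl
  have hm : ∀ t, Measurable (brg (es e).1 (et e).1 true t) := meas_brg P h _ _ _
  have hI0 : (0 : ℝ) ∈ Icc (0 : ℝ) 4 := by simp
  have hI4 : (4 : ℝ) ∈ Icc (0 : ℝ) 4 := by simp
  rw [hq]
  set u := x (es e) with hu
  set w := x (et e) with hw
  by_cases hc1 : lam < u ∧ lam < w
  · obtain ⟨h1, h2⟩ := hc1
    have hab : 0 < (u - lam) + (w - lam) := by linarith
    have ht := (brg_tail P h e (u - lam) (w - lam) (u * w) (by linarith) (by linarith)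
      (by nlinarith)).2
    set t := 4 * (u - lam) / ((u - lam) + (w - lam)) with htd
    have hI : t ∈ Icc (0 : ℝ) 4 := by
      refine ⟨div_nonneg (by linarith) hab.le, ?_⟩
      rw [htd, div_le_iff₀ hab]; linarith
    have hlin : (1 - t / 4) * u + t / 4 * w = lam +
        2 * (u - lam) * (w - lam) / ((u - lam) + (w - lam)) := by
      rw [htd]; field_simp; ring
    set M := {ω | brg (es e).1 (et e).1 true t ω ≤
      -(2 * (u - lam) * (w - lam) / ((u - lam) + (w - lam)))} with hM
    have hMm : MeasurableSet M := measurableSet_le (hm t) measurable_const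
    have hsub : {ω | (x, bb N brg e ω) ∈ FF lam e} ⊆ Mᶜ := by
      intro ω hω hM'
      rw [mem_ofPred_eq, FF_iff P h] at hω
      rw [hM, mem_ofPred_eq] at hM'
      rcases hω with hω | hω
      · have := hω t hI
        rw [← hu, ← hw, hlin] at this
        linarith
      · have := hω 0 hI0
        rw [hb0] at this
        simp only [zero_div, sub_zero, one_mul, zero_mul, add_zero, ← hu] at this
        linarith
    have := measureReal_mono (μ := P) hsub
    rw [probReal_compl_eq_one_sub hMm] at this
    linarith
  · by_cases hc2 : u < -lam ∧ w < -lam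
    · obtain ⟨h1, h2⟩ := hc2
      have hab : 0 < (-lam - u) + (-lam - w) := by linarith
      have ht := (brg_tail P h e (-lam - u) (-lam - w) (u * w) (by linarith) (by linarith)
        (by nlinarith)).1
      set t := 4 * (-lam - u) / ((-lam - u) + (-lam - w)) with htd
      have hI : t ∈ Icc (0 : ℝ) 4 := by
        refine ⟨div_nonneg (by linarith) hab.le, ?_⟩
        rw [htd, div_le_iff₀ hab]; linarith
      have hlin : (1 - t / 4) * u + t / 4 * w = -lam -
          2 * (-lam - u) * (-lam - w) / ((-lam - u) + (-lam - w)) := by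
        rw [htd]; field_simp; ring
      set M := {ω | 2 * (-lam - u) * (-lam - w) / ((-lam - u) + (-lam - w)) ≤
        brg (es e).1 (et e).1 true t ω} with hM
      have hMm : MeasurableSet M := measurableSet_le measurable_const (hm t)
      have hsub : {ω | (x, bb N brg e ω) ∈ FF lam e} ⊆ Mᶜ := by
        intro ω hω hM'
        rw [mem_ofPred_eq, FF_iff P h] at hω
        rw [hM, mem_ofPred_eq] at hM'
        rcases hω with hω | hω
        · have := hω 0 hI0
          rw [hb0] at this
          simp only [zero_div, sub_zero, one_mul, zero_mul, add_zero, ← hu] at this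
          linarith
        · have := hω t hI
          rw [← hu, ← hw, hlin] at this
          linarith
      have := measureReal_mono (μ := P) hsub
      rw [probReal_compl_eq_one_sub hMm] at this
      linarith
    · have hemp : {ω | (x, bb N brg e ω) ∈ FF lam e} = ∅ := by
        rw [eq_empty_iff_forall_notMem]
        intro ω hω
        rw [mem_ofPred_eq, FF_iff P h] at hω
        rcases hω with hω | hω
        · have a1 := hω 0 hI0
          have a2 := hω 4 hI4
          rw [hb0] at a1
          rw [hb4] at a2
          norm_num at a1 a2
          exact hc1 ⟨a1, a2⟩
        · have a1 := hω 0 hI0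
          have a2 := hω 4 hI4
          rw [hb0] at a1
          rw [hb4] at a2
          norm_num at a1 a2
          exact hc2 ⟨a1, a2⟩
      rw [hemp, measureReal_empty, sub_nonneg]
      rw [div_le_one (Real.cosh_pos _)]
      exact Real.one_le_cosh _

lemma pOpen_meas (lam : ℝ) (e : Et N) : Measurable (pOpen P brg lam e) := by
  have : IsProbabilityMeasure (P.map (bb N brg e)) :=
    Measure.isProbabilityMeasure_map (meas_bb P h e).aemeasurable
  exact (measurable_measure_prodMk_left (meas_FF lam e)).ennreal_toReal

def osetO (N : ℕ) (η : ℤ × ℤ → Ω → ℝ) (brg : (ℤ × ℤ) → (ℤ × ℤ) → Bool → ℝ → Ω → ℝ) (lam : ℝ)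
    (ω : Ω) : Finset (Et N) :=
  Finset.univ.filter fun e => (XX N η ω, bb N brg e ω) ∈ FF lam e

lemma meas_osetO (lam : ℝ) (e : Et N) : MeasurableSet {ω | e ∈ osetO N η brg lam ω} := by
  simp only [osetO, Finset.mem_filter, Finset.mem_univ, true_and]
  exact ((meas_XX P h).prodMk (meas_bb P h e)) (meas_FF lam e)

lemma law_O (lam : ℝ) (A : Finset (Et N)) : P.real {ω | osetO N η brg lam ω = A} =
    (ZZ (es (N := N)) et Finset.univ)⁻¹ * ∫ x, gw x *
      Real.exp (∑ e, KK (es (N := N)) et e x) * wO (pOpen P brg lam) A x := by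
  have e1 : {ω | osetO N η brg lam ω = A} =
      {ω | ∀ e, (XX N η ω, bb N brg e ω) ∈ FF lam e ↔ e ∈ A} := by
    ext ω
    simp [osetO, Finset.ext_iff]
  rw [e1, mix P (XX N η) (meas_XX P h) (bb N brg) (meas_bb P h) (indep_XX P h) (indep_bb P h)
    (FF lam) (meas_FF lam) A, law_XX P h]
  have hZ : 0 ≤ (ZZ (es (N := N)) et Finset.univ)⁻¹ := by
    refine inv_nonneg.2 (integral_nonneg fun x => ?_)
    unfold gw; positivity
  have hmm : Measurable fun x : Vt N → ℝ => (ZZ (es (N := N)) et Finset.univ)⁻¹ *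
      (gw x * Real.exp (∑ e, KK (es (N := N)) et e x)) := by
    have := fun e => meas_KK (es (N := N)) et e
    have := meas_gw (V := Vt N)
    fun_prop
  rw [integral_withDensity_eq_integral_toReal_smul hmm.ennreal_ofReal
    (Filter.Eventually.of_forall fun x => ENNReal.ofReal_lt_top), ← integral_const_mul]
  refine integral_congr_ae (Filter.Eventually.of_forall fun x => ?_)
  simp only
  rw [ENNReal.toReal_ofReal, smul_eq_mul, mul_assoc]
  · rfl
  · refine mul_nonneg hZ ?_
    unfold gw; positivity

def ext (A : Finset (Et N)) (e : (ℤ × ℤ) × (ℤ × ℤ)) : Bool := decide (inB A e.1 e.2)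

omit h [MeasurableSpace Ω] in
lemma mval2_symm (h3 : ∀ u v b t ω, brg u v b t ω = brg v u b (edgeLen b - t) ω)
    (u v : ℤ × ℤ) (s : ℝ) (ω : Ω) :
    mval2 η brg u v true s ω = mval2 η brg v u true (4 - s) ω := by
  unfold mval2
  rw [h3 u v]
  simp only [edgeLen, if_true]
  ring

lemma oInd_ext (lam : ℝ) (hlam : 2 ≤ lam) :
    ∀ᵐ ω ∂P, oInd N η brg lam ω = ext (osetO N η brg lam ω) := by
  have hb : ∀ᵐ ω ∂P, ∀ u ∈ bdry N, η u ω = 0 := by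
    rw [Finset.eventually_all]
    exact fun u hu => η_bdry P h hu
  filter_upwards [hb] with ω hω
  set Op : ℤ × ℤ → ℤ × ℤ → Prop := fun u v => 
      ((∀ s ∈ Set.Icc (0 : ℝ) 4, lam < mval2 η brg u v true s ω) ∨
        ∀ s ∈ Set.Icc (0 : ℝ) 4, mval2 η brg u v true s ω < -lam) with hOp
  have hsym : ∀ u v, Op u v → Op v u := by
    intro u v huv
    have hI : ∀ s ∈ Icc (0 : ℝ) 4, 4 - s ∈ Icc (0 : ℝ) 4 := fun s hs =>
      ⟨by linarith [hs.2], by linarith [hs.1]⟩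
    rcases huv with huv | huv
    · left; intro s hs
      rw [mval2_symm h.2.2.2.1]; exact huv _ (hI s hs)
    · right; intro s hs
      rw [mval2_symm h.2.2.2.1]; exact huv _ (hI s hs)
  have hbd : ∀ u v, Op u v → u ∉ bdry N := by
    intro u v huv hu
    have hI0 : (0 : ℝ) ∈ Icc (0 : ℝ) 4 := by simp
    have h0 : mval2 η brg u v true 0 ω = 0 := by
      simp [mval2, h.2.1, hω u hu]
    rcases huv with huv | huv
    · have := huv 0 hI0; linarith
    · have := huv 0 hI0; linarith
  have hmem : ∀ e : Et N, e ∈ osetO N η brg lam ω ↔ Op (es e).1 (et e).1 := by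
    intro e
    simp only [osetO, Finset.mem_filter, Finset.mem_univ, true_and]
    rw [FF_iff P h]
    simp only [hOp, mval2, edgeLen, if_true]
    rfl
  funext ⟨u, v⟩
  have key : (u ∈ box N ∧ v ∈ box N ∧ adj u v ∧ Op u v) ↔ inB (osetO N η brg lam ω) u v := by
    constructor
    · rintro ⟨hu, hv, hadj, hO⟩
      have hu' : u ∈ interiorBox N := Finset.mem_sdiff.2 ⟨hu, hbd _ _ hO⟩
      have hv' : v ∈ interiorBox N := Finset.mem_sdiff.2 ⟨hv, hbd _ _ (hsym _ _ hO)⟩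
      rcases adj_iff.1 hadj with ho | ho
      · exact ⟨⟨(⟨u, hu'⟩, ⟨v, hv'⟩), ho⟩, (hmem _).2 hO, Or.inl ⟨rfl, rfl⟩⟩
      · exact ⟨⟨(⟨v, hv'⟩, ⟨u, hu'⟩), ho⟩, (hmem _).2 (hsym _ _ hO), Or.inr ⟨rfl, rfl⟩⟩
    · intro hB
      have hadj := inB_adj hB
      obtain ⟨e, he, ⟨rfl, rfl⟩ | ⟨rfl, rfl⟩⟩ := hB
      · exact ⟨(Finset.mem_sdiff.1 (es e).2).1, (Finset.mem_sdiff.1 (et e).2).1, hadj, (hmem e).1 he⟩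
      · exact ⟨(Finset.mem_sdiff.1 (et e).2).1, (Finset.mem_sdiff.1 (es e).2).1, hadj,
          hsym _ _ ((hmem e).1 he)⟩
  unfold oInd ext
  by_cases hk : inB (osetO N η brg lam ω) u v
  · rw [if_pos (key.2 hk)]; simp [hk]
  · rw [if_neg (fun hh => hk (key.1 hh))]; simp [hk]

omit h [MeasurableSpace Ω]
lemma lInd_ext (C : List (ℤ × ℤ) → Ω → ℕ) (ω : Ω) : lInd N C ω = ext (oset N C ω) := by
  funext ⟨u, v⟩
  have hsym : ∀ u v, loopEdgeOpen N C ω u v → loopEdgeOpen N C ω v u := by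
    rintro u v ⟨L, h1, h2, h3⟩
    exact ⟨L, h1, h2, h3.symm⟩
  have hint : ∀ u v, loopEdgeOpen N C ω u v → u ∈ interiorBox N := by
    rintro u v ⟨L, h1, h2, ⟨i, rfl, _⟩ | ⟨i, _, rfl⟩⟩
    · exact h1.2.1 _ (List.get_mem _ _)
    · exact h1.2.1 _ (List.get_mem _ _)
  have hmem : ∀ e : Et N, e ∈ oset N C ω ↔ loopEdgeOpen N C ω (es e).1 (et e).1 := by
    intro e
    simp [oset]
  have key : (u ∈ box N ∧ v ∈ box N ∧ adj u v ∧ loopEdgeOpen N C ω u v) ↔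
      inB (oset N C ω) u v := by
    constructor
    · rintro ⟨hu, hv, hadj, hO⟩
      have hu' : u ∈ interiorBox N := hint _ _ hO
      have hv' : v ∈ interiorBox N := hint _ _ (hsym _ _ hO)
      rcases adj_iff.1 hadj with ho | ho
      · exact ⟨⟨(⟨u, hu'⟩, ⟨v, hv'⟩), ho⟩, (hmem _).2 hO, Or.inl ⟨rfl, rfl⟩⟩
      · exact ⟨⟨(⟨v, hv'⟩, ⟨u, hu'⟩), ho⟩, (hmem _).2 (hsym _ _ hO), Or.inr ⟨rfl, rfl⟩⟩
    · intro hB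
      have hadj := inB_adj hB
      obtain ⟨e, he, ⟨rfl, rfl⟩ | ⟨rfl, rfl⟩⟩ := hB
      · exact ⟨(Finset.mem_sdiff.1 (es e).2).1, (Finset.mem_sdiff.1 (et e).2).1, hadj, (hmem e).1 he⟩
      · exact ⟨(Finset.mem_sdiff.1 (et e).2).1, (Finset.mem_sdiff.1 (es e).2).1, hadj,
          hsym _ _ ((hmem e).1 he)⟩
  unfold lInd ext
  by_cases hk : inB (oset N C ω) u v
  · rw [if_pos (key.2 hk)]; simp [hk]
  · rw [if_neg (fun hh => hk (key.1 hh))]; simp [hk]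

end E3
end Aux



namespace Aux
section F

lemma fin_law {Ω E I : Type} [Fintype E] [MeasurableSpace Ω] (P : Measure Ω)
    [IsProbabilityMeasure P] (f : Ω → Finset E) (hf : ∀ A, MeasurableSet {ω | f ω = A})
    (g : Finset E → I → Bool) {T : Type} [MeasurableSpace T] (Q : Measure T)
    [IsFiniteMeasure Q] (X : T → Finset E) (hX : ∀ A, MeasurableSet {ω | X ω = A})
    (hQ : ∀ A, Q.real {ω | X ω = A} = P.real {ω | f ω = A}) :
    Q.map (fun ω => g (X ω)) = P.map (fun ω => g (f ω)) := by
  let : MeasurableSpace (Finset E) := ⊤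
  have hfm : Measurable f := measurable_to_countable' fun A => hf A
  have hXm : Measurable X := measurable_to_countable' fun A => hX A
  have hg : Measurable g := measurable_from_top
  have e1 : Q.map (fun ω => g (X ω)) = (Q.map X).map g := (Measure.map_map hg hXm).symm
  have e2 : P.map (fun ω => g (f ω)) = (P.map f).map g := (Measure.map_map hg hfm).symm
  rw [e1, e2]
  congr 1
  refine Measure.ext_of_singleton fun A => ?_
  rw [Measure.map_apply hXm trivial, Measure.map_apply hfm trivial]
  have := hQ A
  exact (measureReal_eq_measureReal_iff).1 this

lemma sum_prob {Ω E : Type} [Fintype E] [MeasurableSpace Ω] (P : Measure Ω)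
    [IsProbabilityMeasure P] (f : Ω → Finset E) (hf : ∀ A, MeasurableSet {ω | f ω = A}) :
    ∑ A, P.real {ω | f ω = A} = 1 := by
  rw [← measureReal_iUnion_fintype]
  · have : (⋃ A, {ω | f ω = A}) = univ := by ext ω; simp
    rw [this, probReal_univ]
  · intro A B hAB
    rw [Function.onFun, Set.disjoint_left]
    intro ω h1 h2
    exact hAB (h1.symm.trans h2)
  · exact hf

lemma couple {E : Type} [Fintype E] (c : Finset E → Finset E → ℝ)
    (hc0 : ∀ A B, 0 ≤ c A B) (hcs : ∀ A B, c A B ≠ 0 → A ⊆ B) (a l : Finset E → ℝ)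
    (hcA : ∀ A, ∑ B, c A B = a A) (hcB : ∀ B, ∑ A, c A B = l B) (ha : ∑ A, a A = 1) :
    ∃ Q : @Measure (Finset E × Finset E) ⊤, @IsProbabilityMeasure _ ⊤ Q ∧
      (∀ A, @Measure.real _ ⊤ Q {p | p.1 = A} = a A) ∧
      (∀ B, @Measure.real _ ⊤ Q {p | p.2 = B} = l B) ∧
      (∀ᵐ p ∂Q, p.1 ⊆ p.2) := by
  let mT : MeasurableSpace (Finset E × Finset E) := ⊤
  set Q : Measure (Finset E × Finset E) :=
    ∑ p : Finset E × Finset E, ENNReal.ofReal (c p.1 p.2) • Measure.dirac p with hQ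
  have hQs : ∀ S : Set (Finset E × Finset E), Q S =
      ENNReal.ofReal (∑ A, ∑ B, if (A, B) ∈ S then c A B else 0) := by
    intro S
    have hS : MeasurableSet S := MeasurableSpace.measurableSet_top
    rw [hQ, Measure.finsetSum_apply, ← Fintype.sum_prod_type',
      ENNReal.ofReal_sum_of_nonneg (fun p _ => by split_ifs <;> simp [hc0])]
    refine Finset.sum_congr rfl fun p _ => ?_
    rw [Measure.smul_apply, Measure.dirac_apply' _ hS, smul_eq_mul]
    by_cases hp : p ∈ S <;> simp [hp]
  have ha0 : ∀ A, 0 ≤ a A := fun A => by rw [← hcA]; exact Finset.sum_nonneg fun B _ => hc0 A B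
  have hl0 : ∀ A, 0 ≤ l A := fun A => by rw [← hcB]; exact Finset.sum_nonneg fun B _ => hc0 B A
  refine ⟨Q, ⟨?_⟩, ?_, ?_, ?_⟩
  · rw [hQs]
    simp only [mem_univ, if_true, hcA]
    rw [ha, ENNReal.ofReal_one]
  · intro A
    have : Q {p | p.1 = A} = ENNReal.ofReal (a A) := by
      rw [hQs, ← hcA A]
      congr 1
      rw [Finset.sum_eq_single A]
      · simp
      · intro A' _ hA'; simp [hA']
      · simp
    rw [Measure.real, this, ENNReal.toReal_ofReal (ha0 A)]
  · intro B
    have : Q {p | p.2 = B} = ENNReal.ofReal (l B) := by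
      rw [hQs, ← hcB B]
      congr 1
      refine Finset.sum_congr rfl fun A _ => ?_
      rw [Finset.sum_eq_single B]
      · simp
      · intro B' _ hB'; simp [hB']
      · simp
    rw [Measure.real, this, ENNReal.toReal_ofReal (hl0 B)]
  · rw [ae_iff, hQs, ENNReal.ofReal_eq_zero]
    refine le_of_eq (Finset.sum_eq_zero fun A _ => Finset.sum_eq_zero fun B _ => ?_)
    split_ifs with hp
    · by_contra hne
      exact hp (hcs A B hne)
    · rfl

end F
end Aux

/-- For any `λ ≥ 2`, the family of edge indicators of `O` (edges of `V_N`
on whose copy `e(1)` the metric-graph GFF `η̃'_N` stays `> λ` or stays `< -λ`) is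
stochastically dominated by the family of edge indicators of the critical random walk loop
soup `L_{1/2,N}`: there is a coupling of the two families which is a.s. pointwise ordered. -/
theorem stmt11 (N : ℕ) (hN : 1 ≤ N) (lam : ℝ) (hlam : 2 ≤ lam)
    (Ω₁ : Type) (_ : MeasurableSpace Ω₁) (P₁ : Measure Ω₁) (hP₁ : IsProbabilityMeasure P₁)
    (η : ℤ × ℤ → Ω₁ → ℝ) (brg : (ℤ × ℤ) → (ℤ × ℤ) → Bool → ℝ → Ω₁ → ℝ)
    (hgff : IsMetricGFF2 N P₁ η brg)
    (Ω₂ : Type) (_ : MeasurableSpace Ω₂) (P₂ : Measure Ω₂) (hP₂ : IsProbabilityMeasure P₂)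
    (C : List (ℤ × ℤ) → Ω₂ → ℕ) (hsoup : IsLoopSoup N (1 / 2) P₂ C) :
    ∃ (Ω : Type) (_ : MeasurableSpace Ω) (Q : Measure Ω) (_ : IsProbabilityMeasure Q)
      (X Y : Ω → (ℤ × ℤ) × (ℤ × ℤ) → Bool),
        Measurable X ∧ Measurable Y ∧
        Q.map X = P₁.map (fun ω => oInd N η brg lam ω) ∧
        Q.map Y = P₂.map (fun ω => lInd N C ω) ∧
        ∀ᵐ ω ∂Q, ∀ e, X ω e ≤ Y ω e := by
  obtain ⟨c, hc0, hcs, hcA, hcB⟩ := Aux.coupling (Aux.es (N := N)) Aux.et Aux.hint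
    (Aux.pOpen P₁ brg lam) (Aux.pOpen_meas P₁ hgff lam) (fun e x => measureReal_nonneg)
    (Aux.pOpen_le P₁ hgff lam hlam)
    (fun A => P₁.real {ω | Aux.osetO N η brg lam ω = A})
    (fun B => P₂.real {ω | Aux.oset N C ω = B})
    (Aux.law_O P₁ hgff lam) (Aux.sum_law P₂ C hsoup)
  have hO := Aux.meas_fin_eq (Aux.osetO N η brg lam) (Aux.meas_osetO P₁ hgff lam)
  have hL := Aux.meas_fin_eq (Aux.oset N C) (Aux.meas_oset C hsoup.1)
  let mT : MeasurableSpace (Finset (Aux.Et N) × Finset (Aux.Et N)) := ⊤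
  obtain ⟨Q, hprob, hQ1, hQ2, hQ3⟩ := Aux.couple c hc0 hcs _ _ hcA hcB
    (Aux.sum_prob P₁ (Aux.osetO N η brg lam) hO)
  refine ⟨_, mT, Q, hprob, fun p => Aux.ext p.1, fun p => Aux.ext p.2, measurable_from_top,
    measurable_from_top, ?_, ?_, ?_⟩
  · rw [Measure.map_congr (Aux.oInd_ext P₁ hgff lam hlam)]
    exact Aux.fin_law P₁ _ hO Aux.ext Q Prod.fst (fun A => trivial) fun A => hQ1 A
  · simp only [Aux.lInd_ext]
    exact Aux.fin_law P₂ _ hL Aux.ext Q Prod.snd (fun A => trivial) fun A => hQ2 A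
  · filter_upwards [hQ3] with p hsub e
    simp only [Aux.ext]
    by_cases hA : Aux.inB p.1 e.1 e.2
    · obtain ⟨f, hf, hh⟩ := hA
      have : Aux.inB p.2 e.1 e.2 := ⟨f, hsub hf, hh⟩
      simp [this]
    · simp [hA]


end
end

section
/- For any point w ∈ G̃'_N lying on an edge e(1) = (v,v') ∈ E_N(1), and any constants C, C₁ > 0 (which may be taken arbitrarily large), there exists a function f : G̃'_N → ℝ that is harmonic on G̃'_N ∖ ({w} ∪ ∂V_N) — meaning the restriction of f to V_N ∪ {w} is discrete-harmonic on the graph (V_N ∪ {w}, E'_{N,w}) except at w and at ∂V_N, and f is linear on each segment of E'_{N,w} — and satisfies |f(u) − C·log(|u−w| + 2) − C₁| ≤ L(C) for all u ∈ G̃'_N, where L(C) depends only on C; in particular, choosing C₁ > L(C), f(u) > 0 for all u ∈ G̃'_N. -/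
open MeasureTheory ProbabilityTheory Set

attribute [local instance] Classical.propDecidable

noncomputable section

/-! ### Statement 14: a positive harmonic function with a logarithmic profile around a point
`w` of an edge `e(1) = (v,v')` of the metric graph `G̃'_N`. -/

/-- The point of `G̃'_N` on the copy `b` of the edge `(x,y)` at metric distance `t` from `x`,
embedded in the plane (`e(1)` and `e(2)` are both embedded onto the straight lattice edge). -/
def embPt (x y : ℤ × ℤ) (b : Bool) (t : ℝ) : ℝ × ℝ :=
  ((x.1 : ℝ) + (t / edgeLen b) * ((y.1 : ℝ) - (x.1 : ℝ)),
    (x.2 : ℝ) + (t / edgeLen b) * ((y.2 : ℝ) - (x.2 : ℝ)))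

/-- Euclidean distance in the plane. -/
def eDist (p q : ℝ × ℝ) : ℝ := Real.sqrt ((p.1 - q.1) ^ 2 + (p.2 - q.2) ^ 2)

/-- The function on `G̃'_N` determined by vertex values `fV`, the value `fw` at the point `w`
sitting on the copy `e(1)` of the edge `(v,v')` at (Euclidean) position `s ∈ (0,1)` along it
(metric distance `4s` from `v`), and linear interpolation along every segment of `E'_{N,w}`. -/
def mfval (v v' : ℤ × ℤ) (s : ℝ) (fV : ℤ × ℤ → ℝ) (fw : ℝ)
    (x y : ℤ × ℤ) (b : Bool) (t : ℝ) : ℝ :=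
  if b = true ∧ x = v ∧ y = v' then
    (if t ≤ 4 * s then fV v + (t / (4 * s)) * (fw - fV v)
     else fw + ((t - 4 * s) / (4 * (1 - s))) * (fV v' - fw))
  else if b = true ∧ x = v' ∧ y = v then
    (if 4 - t ≤ 4 * s then fV v + ((4 - t) / (4 * s)) * (fw - fV v)
     else fw + ((4 - t - 4 * s) / (4 * (1 - s))) * (fV v' - fw))
  else fV x + (t / edgeLen b) * (fV y - fV x)

/-! ### Helper lemmas -/

lemma h_log4_le {a b c d Q : ℝ} (ha : 0 < a) (hb : 0 < b) (hc : 0 < c) (hd : 0 < d) (hQ : 0 < Q)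
    (h : Q ^ 4 ≤ a * b * c * d) :
    4 * Real.log Q ≤ Real.log a + Real.log b + Real.log c + Real.log d := by
  have := Real.log_le_log (by positivity) h
  rw [Real.log_mul (by positivity) (by positivity), Real.log_mul (by positivity) (by positivity),
    Real.log_mul (by positivity) (by positivity), Real.log_pow] at this
  simpa using this

lemma h_log4_ge {a b c d Q : ℝ} (ha : 0 < a) (hb : 0 < b) (hc : 0 < c) (hd : 0 < d)
    (h : a * b * c * d ≤ Q ^ 4) :
    Real.log a + Real.log b + Real.log c + Real.log d ≤ 4 * Real.log Q := by
  have := Real.log_le_log (by positivity) h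
  rw [Real.log_mul (by positivity) (by positivity), Real.log_mul (by positivity) (by positivity),
    Real.log_mul (by positivity) (by positivity), Real.log_pow] at this
  simpa using this

def hT (f : ℤ × ℤ → ℝ) (u : ℤ × ℤ) : ℝ :=
  if u = (0, 0) then f u else
    (f (u.1 + 1, u.2) + f (u.1 - 1, u.2) + f (u.1, u.2 + 1) + f (u.1, u.2 - 1)) / 4

def hgm (u : ℤ × ℤ) : ℝ := Real.log ((u.1 : ℝ) ^ 2 + (u.2 : ℝ) ^ 2 + 1) - Real.log 100

def hgp (u : ℤ × ℤ) : ℝ :=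
  if u = (0, 0) then - Real.log 50 else Real.log (4 * ((u.1 : ℝ) ^ 2 + (u.2 : ℝ) ^ 2) - 2)

lemma h_sq_ge_one {x y : ℤ} (h : (x, y) ≠ (0, 0)) : (1 : ℝ) ≤ (x : ℝ) ^ 2 + (y : ℝ) ^ 2 := by
  have : (1 : ℤ) ≤ x ^ 2 + y ^ 2 := by
    by_contra hc
    have h1 : x ^ 2 = 0 := by nlinarith [sq_nonneg x, sq_nonneg y]
    have h2 : y ^ 2 = 0 := by nlinarith [sq_nonneg x, sq_nonneg y]
    simp at h1 h2
    exact h (by rw [h1, h2])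
  exact_mod_cast this

lemma hT_mono : Monotone hT := by
  intro f g hfg u
  unfold hT
  split_ifs
  · exact hfg u
  · have := hfg (u.1 + 1, u.2)
    have := hfg (u.1 - 1, u.2)
    have := hfg (u.1, u.2 + 1)
    have := hfg (u.1, u.2 - 1)
    linarith

lemma hgm_sub : hgm ≤ hT hgm := by
  rintro ⟨x, y⟩
  unfold hT
  split_ifs
  · exact le_rfl
  · simp only [hgm]
    push_cast
    have := h_log4_le (a := ((x : ℝ) + 1) ^ 2 + (y : ℝ) ^ 2 + 1) (b := ((x : ℝ) - 1) ^ 2 + (y : ℝ) ^ 2 + 1)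
      (c := (x : ℝ) ^ 2 + ((y : ℝ) + 1) ^ 2 + 1) (d := (x : ℝ) ^ 2 + ((y : ℝ) - 1) ^ 2 + 1)
      (Q := (x : ℝ) ^ 2 + (y : ℝ) ^ 2 + 1)
      (by positivity) (by positivity) (by positivity) (by positivity) (by positivity)
      (by nlinarith [sq_nonneg ((x : ℝ) * y), sq_nonneg ((x : ℝ)), sq_nonneg ((y : ℝ)),
            sq_nonneg ((x : ℝ) ^ 2 + (y : ℝ) ^ 2)])
    linarith

lemma hgp_super : hT hgp ≤ hgp := by
  rintro ⟨x, y⟩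
  unfold hT
  split_ifs with h0
  · exact le_rfl
  have hq := h_sq_ge_one h0
  by_cases h1 : x ^ 2 + y ^ 2 = 1
  · have key : Real.log 14 + Real.log 6 + Real.log 6 + Real.log (1 / 50) ≤ 4 * Real.log 2 := by
      apply h_log4_ge <;> norm_num
    have e1 : Real.log (1 / 50) = - Real.log 50 := by
      rw [one_div, Real.log_inv]
    have hx : x = 0 ∨ x = 1 ∨ x = -1 := by
      have : x ≤ 1 := by nlinarith
      have : -1 ≤ x := by nlinarith
      omega
    have hy : y = 0 ∨ y = 1 ∨ y = -1 := by
      have : y ≤ 1 := by nlinarith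
      have : -1 ≤ y := by nlinarith
      omega
    rcases hx with rfl | rfl | rfl <;> rcases hy with rfl | rfl | rfl <;>
      first
      | (exfalso; norm_num at h1; done)
      | (norm_num [hgp, Prod.ext_iff]; linarith)
  · have n1 : (x + 1, y) ≠ (0, 0) := by
      intro h; simp only [Prod.mk.injEq] at h; obtain ⟨a, b⟩ := h
      apply h1; have : x = -1 := by omega
      subst this; subst b; norm_num
    have n2 : (x - 1, y) ≠ (0, 0) := by
      intro h; simp only [Prod.mk.injEq] at h; obtain ⟨a, b⟩ := h
      apply h1; have : x = 1 := by omega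
      subst this; subst b; norm_num
    have n3 : (x, y + 1) ≠ (0, 0) := by
      intro h; simp only [Prod.mk.injEq] at h; obtain ⟨b, a⟩ := h
      apply h1; have : y = -1 := by omega
      subst this; subst b; norm_num
    have n4 : (x, y - 1) ≠ (0, 0) := by
      intro h; simp only [Prod.mk.injEq] at h; obtain ⟨b, a⟩ := h
      apply h1; have : y = 1 := by omega
      subst this; subst b; norm_num
    simp only [hgp, if_neg n1, if_neg n2, if_neg n3, if_neg n4, if_neg h0]
    have q1 := h_sq_ge_one n1
    have q2 := h_sq_ge_one n2
    have q3 := h_sq_ge_one n3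
    have q4 := h_sq_ge_one n4
    push_cast at q1 q2 q3 q4 ⊢
    have := h_log4_ge (a := 4 * (((x : ℝ) + 1) ^ 2 + (y : ℝ) ^ 2) - 2)
      (b := 4 * (((x : ℝ) - 1) ^ 2 + (y : ℝ) ^ 2) - 2)
      (c := 4 * ((x : ℝ) ^ 2 + ((y : ℝ) + 1) ^ 2) - 2) (d := 4 * ((x : ℝ) ^ 2 + ((y : ℝ) - 1) ^ 2) - 2)
      (Q := 4 * ((x : ℝ) ^ 2 + (y : ℝ) ^ 2) - 2)
      (by linarith) (by linarith) (by linarith) (by linarith)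
      (by nlinarith [sq_nonneg ((x : ℝ) ^ 2 - (y : ℝ) ^ 2)])
    linarith

lemma hgm_le_hgp : hgm ≤ hgp := by
  rintro ⟨x, y⟩
  unfold hgm hgp
  have h100 : Real.log 50 ≤ Real.log 100 := Real.log_le_log (by norm_num) (by norm_num)
  have h0' : 0 ≤ Real.log 100 := Real.log_nonneg (by norm_num)
  split_ifs with h0
  · simp only [Prod.mk.injEq] at h0
    obtain ⟨rfl, rfl⟩ := h0
    simp; exact h100
  · have hq := h_sq_ge_one h0
    have : Real.log ((x : ℝ) ^ 2 + (y : ℝ) ^ 2 + 1) ≤ Real.log (4 * ((x : ℝ) ^ 2 + (y : ℝ) ^ 2) - 2) :=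
      Real.log_le_log (by positivity) (by linarith)
    simp only
    linarith

def hF (n : ℕ) : ℤ × ℤ → ℝ := hT^[n] hgm

lemma hF_mono : Monotone hF := hT_mono.monotone_iterate_of_le_map hgm_sub

lemma hF_succ (n : ℕ) : hF (n + 1) = hT (hF n) := Function.iterate_succ_apply' _ _ _

lemma hF_le (n : ℕ) : hF n ≤ hgp := by
  induction n with
  | zero => exact hgm_le_hgp
  | succ n ih => rw [hF_succ]; exact (hT_mono ih).trans hgp_super

lemma hF_swap (n : ℕ) : ∀ x y, hF n (x, y) = hF n (y, x) := by
  induction n with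
  | zero => intro x y; simp [hF, hgm, add_comm]
  | succ n ih =>
    intro x y
    rw [hF_succ]
    simp only [hT, Prod.mk.injEq]
    rw [ih x y, ih (x + 1) y, ih (x - 1) y, ih x (y + 1), ih x (y - 1)]
    split_ifs <;> first | (exfalso; tauto; done) | ring

lemma hF_neg (n : ℕ) : ∀ x y, hF n (-x, y) = hF n (x, y) := by
  induction n with
  | zero => intro x y; simp [hF, hgm]
  | succ n ih =>
    intro x y
    rw [hF_succ]
    simp only [hT, Prod.mk.injEq, neg_eq_zero]
    rw [ih x y, ih x (y + 1), ih x (y - 1), show -x + 1 = -(x - 1) by ring,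
      show -x - 1 = -(x + 1) by ring, ih, ih]
    split_ifs <;> ring

def hA (u : ℤ × ℤ) : ℝ := ⨆ n, hF n u

lemma hA_bdd (u : ℤ × ℤ) : BddAbove (Set.range fun n => hF n u) := by
  refine ⟨hgp u, ?_⟩
  rintro _ ⟨n, rfl⟩
  exact hF_le n u

lemma hA_tendsto (u : ℤ × ℤ) : Filter.Tendsto (fun n => hF n u) Filter.atTop (nhds (hA u)) :=
  tendsto_atTop_ciSup (fun _ _ h => hF_mono h u) (hA_bdd u)

lemma hA_le (u : ℤ × ℤ) : hA u ≤ hgp u := ciSup_le fun n => hF_le n u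

lemma hA_ge (u : ℤ × ℤ) : hgm u ≤ hA u := le_ciSup (hA_bdd u) 0

lemma hA_harm (u : ℤ × ℤ) (hu : u ≠ (0, 0)) :
    4 * hA u = hA (u.1 + 1, u.2) + hA (u.1 - 1, u.2) + hA (u.1, u.2 + 1) + hA (u.1, u.2 - 1) := by
  have h1 : Filter.Tendsto (fun n => hF (n + 1) u) Filter.atTop (nhds (hA u)) :=
    (hA_tendsto u).comp (Filter.tendsto_add_atTop_nat 1)
  have h2 := ((((hA_tendsto (u.1 + 1, u.2)).add (hA_tendsto (u.1 - 1, u.2))).add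
    (hA_tendsto (u.1, u.2 + 1))).add (hA_tendsto (u.1, u.2 - 1))).div_const 4
  have h3 : (fun n => hF (n + 1) u) = fun n => (hF n (u.1 + 1, u.2) + hF n (u.1 - 1, u.2) +
      hF n (u.1, u.2 + 1) + hF n (u.1, u.2 - 1)) / 4 := by
    funext n
    rw [hF_succ, hT, if_neg hu]
  rw [h3] at h1
  have := tendsto_nhds_unique h1 h2
  linarith

lemma h_core : ∃ (a : ℤ × ℤ → ℝ) (ρ M : ℝ), 0 ≤ M ∧ a (0, 0) = 0 ∧ a (1, 0) = ρ ∧ a (-1, 0) = ρ ∧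
    a (0, 1) = ρ ∧ a (0, -1) = ρ ∧
    (∀ u, u ≠ (0, 0) →
      4 * a u = a (u.1 + 1, u.2) + a (u.1 - 1, u.2) + a (u.1, u.2 + 1) + a (u.1, u.2 - 1)) ∧
    ∀ u, |a u - 2 * Real.log (Real.sqrt ((u.1 : ℝ) ^ 2 + (u.2 : ℝ) ^ 2) + 2)| ≤ M := by
  have sw : ∀ x y, hA (x, y) = hA (y, x) := fun x y => by simp only [hA, hF_swap _ x y]
  have ng : ∀ x y, hA (-x, y) = hA (x, y) := fun x y => by simp only [hA, hF_neg]
  refine ⟨fun u => hA u - hA (0, 0), hA (1, 0) - hA (0, 0),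
    Real.log 100 + Real.log 8 + Real.log 50 + |hA (0, 0)|, ?_, by simp, rfl, ?_, ?_, ?_, ?_, ?_⟩
  · have := Real.log_nonneg (show (1 : ℝ) ≤ 100 by norm_num)
    have := Real.log_nonneg (show (1 : ℝ) ≤ 8 by norm_num)
    have := Real.log_nonneg (show (1 : ℝ) ≤ 50 by norm_num)
    positivity
  · simp only [ng 1 0]
  · simp only [sw 0 1]
  · simp only [sw 0 (-1), ng 1 0]
  · intro u hu
    have := hA_harm u hu
    simp only
    linarith
  · rintro ⟨x, y⟩
    have l100 := Real.log_nonneg (show (1 : ℝ) ≤ 100 by norm_num)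
    have l8 := Real.log_nonneg (show (1 : ℝ) ≤ 8 by norm_num)
    have l50 := Real.log_nonneg (show (1 : ℝ) ≤ 50 by norm_num)
    have l48 : Real.log 4 ≤ Real.log 8 := Real.log_le_log (by norm_num) (by norm_num)
    simp only
    set q : ℝ := (x : ℝ) ^ 2 + (y : ℝ) ^ 2 with hq
    have hq0 : 0 ≤ q := by positivity
    set r := Real.sqrt q with hr
    have hr0 : 0 ≤ r := Real.sqrt_nonneg _
    have hrq : r ^ 2 = q := Real.sq_sqrt hq0
    have e1 : 2 * Real.log (r + 2) = Real.log ((r + 2) ^ 2) := by rw [Real.log_pow]; norm_num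
    have up : hA (x, y) ≤ Real.log 8 + 2 * Real.log (r + 2) := by
      refine (hA_le _).trans ?_
      have hl := Real.log_nonneg (show (1 : ℝ) ≤ r + 2 by linarith)
      unfold hgp
      split_ifs with h0
      · linarith
      · have := h_sq_ge_one h0
        simp only
        rw [← hq, e1, ← Real.log_mul (by norm_num) (by positivity)]
        exact Real.log_le_log (by linarith) (by nlinarith)
    have lo : 2 * Real.log (r + 2) - Real.log 8 - Real.log 100 ≤ hA (x, y) := by
      refine le_trans ?_ (hA_ge _)
      unfold hgm
      simp only
      rw [← hq]
      have : Real.log ((r + 2) ^ 2) ≤ Real.log 8 + Real.log (q + 1) := by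
        rw [← Real.log_mul (by norm_num) (by positivity)]
        exact Real.log_le_log (by positivity) (by nlinarith [sq_nonneg (r - 1)])
      linarith
    rw [abs_le]
    constructor <;> linarith [le_abs_self (hA (0, 0)), neg_abs_le (hA (0, 0))]

lemma h_sum_nbrs (f : ℤ × ℤ → ℝ) (u : ℤ × ℤ) : ∑ z ∈ nbrs u, f z =
    f (u.1 + 1, u.2) + f (u.1 - 1, u.2) + f (u.1, u.2 + 1) + f (u.1, u.2 - 1) := by
  unfold nbrs
  rw [Finset.sum_insert, Finset.sum_insert, Finset.sum_insert, Finset.sum_singleton]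
  · ring
  all_goals
    simp only [Finset.mem_insert, Finset.mem_singleton, Prod.mk.injEq]
    omega

lemma h_adj_cases {v v' : ℤ × ℤ} (h : adj v v') :
    v' = (v.1 + 1, v.2) ∨ v' = (v.1 - 1, v.2) ∨ v' = (v.1, v.2 + 1) ∨ v' = (v.1, v.2 - 1) := by
  obtain ⟨x, y⟩ := v
  obtain ⟨x', y'⟩ := v'
  simp only [adj] at h
  simp only [Prod.mk.injEq]
  rcases abs_cases (x - x') with h1 | h1 <;> rcases abs_cases (y - y') with h2 | h2 <;> omega

lemma h_adj_symm {v v' : ℤ × ℤ} (h : adj v v') : adj v' v := by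
  unfold adj at *
  rw [abs_sub_comm, abs_sub_comm v'.2]; exact h

lemma h_sum_sdiff (f : ℤ × ℤ → ℝ) {v v' : ℤ × ℤ} (h : adj v v') :
    ∑ z ∈ nbrs v \ {v'}, f z = ∑ z ∈ nbrs v, f z - f v' := by
  have hm : v' ∈ nbrs v := by
    have := h_adj_cases h
    simpa [nbrs] using this
  have := Finset.sum_sdiff (f := f) (Finset.singleton_subset_iff.mpr hm)
  rw [Finset.sum_singleton] at this
  linarith

lemma h_eDist_eq (p q : ℝ × ℝ) :
    eDist p q = ‖(((p.1 - q.1 : ℝ) : ℂ) + ((p.2 - q.2 : ℝ) : ℂ) * Complex.I)‖ := by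
  rw [Complex.norm_add_mul_I, eDist]

lemma h_eDist_tri (p q r : ℝ × ℝ) : eDist p r ≤ eDist p q + eDist q r := by
  rw [h_eDist_eq, h_eDist_eq, h_eDist_eq]
  refine le_trans (le_of_eq ?_) (norm_add_le _ _)
  congr 1
  push_cast
  ring

lemma h_eDist_symm (p q : ℝ × ℝ) : eDist p q = eDist q p := by
  unfold eDist; congr 1; ring

lemma h_eDist_nonneg (p q : ℝ × ℝ) : 0 ≤ eDist p q := Real.sqrt_nonneg _

def hE (x : ℤ × ℤ) : ℝ × ℝ := ((x.1 : ℝ), (x.2 : ℝ))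

/-- point at fraction `τ` of edge -/
def hP (x y : ℤ × ℤ) (τ : ℝ) : ℝ × ℝ :=
  ((x.1 : ℝ) + τ * ((y.1 : ℝ) - (x.1 : ℝ)), (x.2 : ℝ) + τ * ((y.2 : ℝ) - (x.2 : ℝ)))

lemma h_dist_edge {x y : ℤ × ℤ} (h : adj x y) {σ τ : ℝ} (hσ : σ ∈ Set.Icc (0 : ℝ) 1)
    (hτ : τ ∈ Set.Icc (0 : ℝ) 1) : eDist (hP x y σ) (hP x y τ) ≤ 1 := by
  unfold eDist hP
  refine Real.sqrt_le_one.mpr ?_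
  have : |σ - τ| ≤ 1 := by
    rw [abs_le]; constructor <;> linarith [hσ.1, hσ.2, hτ.1, hτ.2]
  have h2 : (σ - τ) ^ 2 ≤ 1 := by
    rw [← sq_abs]; nlinarith [abs_nonneg (σ - τ)]
  rcases h_adj_cases h with rfl | rfl | rfl | rfl <;> push_cast <;> nlinarith

lemma hP_zero (x y : ℤ × ℤ) : hP x y 0 = hE x := by simp [hP, hE]
lemma hP_one (x y : ℤ × ℤ) : hP x y 1 = hE y := by simp [hP, hE]
lemma hP_symm (x y : ℤ × ℤ) (τ : ℝ) : hP x y τ = hP y x (1 - τ) := by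
  unfold hP; ext <;> simp only <;> ring

lemma h_log_close {r r' : ℝ} (hr : 0 ≤ r) (hr' : 0 ≤ r') (h1 : r ≤ r' + 2) (h2 : r' ≤ r + 2) :
    |Real.log (r + 2) - Real.log (r' + 2)| ≤ 1 := by
  have l2 : Real.log 2 ≤ 1 := by linarith [Real.log_two_lt_d9]
  have a1 : Real.log (r + 2) ≤ Real.log 2 + Real.log (r' + 2) := by
    rw [← Real.log_mul (by norm_num) (by positivity)]
    exact Real.log_le_log (by positivity) (by linarith)
  have a2 : Real.log (r' + 2) ≤ Real.log 2 + Real.log (r + 2) := by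
    rw [← Real.log_mul (by norm_num) (by positivity)]
    exact Real.log_le_log (by positivity) (by linarith)
  rw [abs_le]; constructor <;> linarith

lemma h_conv {A B T L τ : ℝ} (hA : |A - T| ≤ L) (hB : |B - T| ≤ L) (h0 : 0 ≤ τ) (h1 : τ ≤ 1) :
    |A + τ * (B - A) - T| ≤ L := by
  rw [abs_le] at *
  constructor <;> nlinarith

/-- The bound at all points, with constants. -/
lemma h_profile {v v' : ℤ × ℤ} (hv : adj v v') {s : ℝ} (hs0 : 0 < s) (hs1 : s < 1)
    {fV : ℤ × ℤ → ℝ} {fw L : ℝ} {T : ℝ × ℝ → ℝ}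
    (H1 : ∀ x p, eDist (hE x) p ≤ 1 → |fV x - T p| ≤ L)
    (H2 : ∀ p, eDist p (hP v v' s) ≤ 1 → |fw - T p| ≤ L)
    (x y : ℤ × ℤ) (b : Bool) (t : ℝ) (hxy : adj x y) (ht : t ∈ Set.Icc (0 : ℝ) (edgeLen b)) :
    |mfval v v' s fV fw x y b t - T (embPt x y b t)| ≤ L := by
  have hl : 0 < edgeLen b := by unfold edgeLen; split_ifs <;> norm_num
  have hτ : t / edgeLen b ∈ Set.Icc (0 : ℝ) 1 :=
    ⟨div_nonneg ht.1 hl.le, (div_le_one hl).2 ht.2⟩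
  have z0 : (0 : ℝ) ∈ Set.Icc (0 : ℝ) 1 := ⟨le_rfl, zero_le_one⟩
  have z1 : (1 : ℝ) ∈ Set.Icc (0 : ℝ) 1 := ⟨zero_le_one, le_rfl⟩
  have zs : s ∈ Set.Icc (0 : ℝ) 1 := ⟨hs0.le, hs1.le⟩
  have hp : embPt x y b t = hP x y (t / edgeLen b) := rfl
  have bx : |fV x - T (embPt x y b t)| ≤ L := by
    apply H1; rw [hp, ← hP_zero x y]; exact h_dist_edge hxy z0 hτ
  have bY : |fV y - T (embPt x y b t)| ≤ L := by
    apply H1; rw [hp, ← hP_one x y]; exact h_dist_edge hxy z1 hτ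
  have hs1' : 0 < 1 - s := by linarith
  unfold mfval
  split_ifs with c1 c2 c3 c4
  · obtain ⟨rfl, rfl, rfl⟩ := c1
    have bw : |fw - T (embPt x y true t)| ≤ L := by
      apply H2; rw [hp]; exact h_dist_edge hxy hτ zs
    exact h_conv bx bw (div_nonneg ht.1 (by positivity)) ((div_le_one (by positivity)).2 c2)
  · obtain ⟨rfl, rfl, rfl⟩ := c1
    have bw : |fw - T (embPt x y true t)| ≤ L := by
      apply H2; rw [hp]; exact h_dist_edge hxy hτ zs
    have h4 : t ≤ 4 := by simpa [edgeLen] using ht.2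
    exact h_conv bw bY (div_nonneg (by linarith) (by positivity))
      ((div_le_one (by positivity)).2 (by linarith))
  · obtain ⟨rfl, rfl, rfl⟩ := c3
    have bw : |fw - T (embPt x y true t)| ≤ L := by
      apply H2; rw [hp, hP_symm y x s]
      exact h_dist_edge hxy hτ ⟨by linarith, by linarith⟩
    have h4 : t ≤ 4 := by simpa [edgeLen] using ht.2
    exact h_conv bY bw (div_nonneg (by linarith) (by positivity))
      ((div_le_one (by positivity)).2 c4)
  · obtain ⟨rfl, rfl, rfl⟩ := c3
    have bw : |fw - T (embPt x y true t)| ≤ L := by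
      apply H2; rw [hp, hP_symm y x s]
      exact h_dist_edge hxy hτ ⟨by linarith, by linarith⟩
    exact h_conv bw bx (div_nonneg (by linarith) (by positivity))
      ((div_le_one (by positivity)).2 (by linarith [ht.1]))
  · exact h_conv bx bY hτ.1 hτ.2

/-- For any point `w` on a copy `e(1)` of an edge `(v,v')` and any
constants `C, C₁ > 0`, there is a function `f` on `G̃'_N`, harmonic away from `{w} ∪ ∂V_N`
(discrete harmonicity on `(V_N ∪ {w}, E'_{N,w})` with conductances `1` between ordinary
neighbours, `7/8` on `e(2) = (v,v')`, `1/(8s)` on `(v,w)` and `1/(8(1-s))` on `(w,v')`; linear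
on each segment), with `|f(u) - C log(|u-w| + 2) - C₁| ≤ L(C)` for all `u ∈ G̃'_N`, where
`L(C)` depends only on `C`; in particular if `C₁ > L(C)` then `f > 0` everywhere. -/
theorem stmt14 :
    ∀ C > (0 : ℝ), ∃ L > (0 : ℝ), ∀ C₁ > (0 : ℝ), ∀ N : ℕ, 1 ≤ N →
      ∀ v v' : ℤ × ℤ, v ∈ box N → v' ∈ box N → adj v v' →
        ∀ s : ℝ, 0 < s → s < 1 →
          ∃ (fV : ℤ × ℤ → ℝ) (fw : ℝ),
            -- discrete harmonicity at every vertex other than `v, v'` away from `∂V_N`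
            (∀ u ∈ box N, u ∉ bdry N → u ≠ v → u ≠ v' →
              (4 : ℝ) * fV u = ∑ z ∈ nbrs u, fV z) ∧
            -- harmonicity at `v` (where the segment `(v,w)` has conductance `1/(8s)`)
            (v ∉ bdry N →
              (3 + 7 / 8 + 1 / (8 * s)) * fV v =
                (∑ z ∈ nbrs v \ {v'}, fV z) + (7 / 8) * fV v' + (1 / (8 * s)) * fw) ∧
            -- harmonicity at `v'` (where the segment `(w,v')` has conductance `1/(8(1-s))`)
            (v' ∉ bdry N →
              (3 + 7 / 8 + 1 / (8 * (1 - s))) * fV v' =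
                (∑ z ∈ nbrs v' \ {v}, fV z) + (7 / 8) * fV v + (1 / (8 * (1 - s))) * fw) ∧
            -- the logarithmic profile, at every point of `G̃'_N`
            (∀ x y : ℤ × ℤ, ∀ b : Bool, ∀ t : ℝ,
              x ∈ box N → y ∈ box N → adj x y → t ∈ Set.Icc (0 : ℝ) (edgeLen b) →
                |mfval v v' s fV fw x y b t -
                    C * Real.log
                      (eDist (embPt x y b t) (embPt v v' true (4 * s)) + 2) - C₁| ≤ L) ∧
            -- positivity when `C₁ > L`
            (L < C₁ → ∀ x y : ℤ × ℤ, ∀ b : Bool, ∀ t : ℝ,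
              x ∈ box N → y ∈ box N → adj x y → t ∈ Set.Icc (0 : ℝ) (edgeLen b) →
                0 < mfval v v' s fV fw x y b t) := by
  intro C hC
  obtain ⟨a, ρ, M, hM, a0, a1, a2, a3, a4, harm, prof⟩ := h_core
  have hL : 0 < C / 2 * (M + 2) + 15 * C * |ρ| + 2 * C := by positivity
  refine ⟨C / 2 * (M + 2) + 15 * C * |ρ| + 2 * C, hL, ?_⟩
  intro C₁ hC₁ N hN v v' hvN hvN' hadj s hs0 hs1
  have hs1' : 0 < 1 - s := by linarith
  set aS : ℤ × ℤ → ℤ × ℤ → ℝ := fun z u => a (u.1 - z.1, u.2 - z.2) with haS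
  -- the shifted kernel
  have S0 : ∀ z, aS z z = 0 := fun z => by simp [haS, a0]
  have Sadj : ∀ z z', adj z z' → aS z z' = ρ := by
    intro z z' h
    rcases h_adj_cases h with rfl | rfl | rfl | rfl <;> simp [haS, a1, a2, a3, a4]
  have Sh : ∀ z u, u ≠ z → 4 * aS z u = ∑ x ∈ nbrs u, aS z x := by
    intro z u hu
    rw [h_sum_nbrs]
    have := harm (u.1 - z.1, u.2 - z.2) (by
      intro h; apply hu
      simp only [Prod.mk.injEq] at h
      ext <;> omega)
    simp only [haS]
    rw [this]
    simp only [add_sub_right_comm, sub_right_comm]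
  have Sz : ∀ z, ∑ x ∈ nbrs z, aS z x = 4 * ρ := by
    intro z
    rw [h_sum_nbrs]
    simp [haS, a1, a2, a3, a4]
    ring
  set K := C / 2 with hK
  have hK0 : 0 < K := by positivity
  set fV : ℤ × ℤ → ℝ := fun u => K * ((1 - s) * aS v u + s * aS v' u) + C₁ with hfV
  set fw : ℝ := -30 * K * ρ * s * (1 - s) + C₁ with hfw
  have hne : v ≠ v' := by
    rintro rfl; simp [adj] at hadj
  have hsum : ∀ u, ∑ z ∈ nbrs u, fV z =
      K * ((1 - s) * ∑ z ∈ nbrs u, aS v z + s * ∑ z ∈ nbrs u, aS v' z) + 4 * C₁ := by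
    intro u
    simp only [h_sum_nbrs, hfV]
    ring
  have hadj' := h_adj_symm hadj
  have fv : fV v = K * (s * ρ) + C₁ := by
    simp only [hfV, S0, Sadj _ _ hadj']; ring
  have fv' : fV v' = K * ((1 - s) * ρ) + C₁ := by
    simp only [hfV, S0, Sadj _ _ hadj]; ring
  have hprof : ∀ x y : ℤ × ℤ, ∀ b : Bool, ∀ t : ℝ,
      x ∈ box N → y ∈ box N → adj x y → t ∈ Set.Icc (0 : ℝ) (edgeLen b) →
        |mfval v v' s fV fw x y b t -
            C * Real.log
              (eDist (embPt x y b t) (embPt v v' true (4 * s)) + 2) - C₁| ≤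
          K * (M + 2) + 15 * C * |ρ| + 2 * C := by
    intro x y b t _ _ hxy ht
    have ew : embPt v v' true (4 * s) = hP v v' s := by
      simp only [embPt, hP, edgeLen]; simp
    rw [ew, sub_sub]
    refine h_profile (T := fun p => C * Real.log (eDist p (hP v v' s) + 2) + C₁)
      hadj hs0 hs1 ?_ ?_ x y b t hxy ht
    · intro x p hp
      have zs : s ∈ Set.Icc (0 : ℝ) 1 := ⟨hs0.le, hs1.le⟩
      have dv : eDist (hE v) (hP v v' s) ≤ 1 := by
        rw [← hP_zero v v']; exact h_dist_edge hadj ⟨le_rfl, zero_le_one⟩ zs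
      have dv' : eDist (hE v') (hP v v' s) ≤ 1 := by
        rw [← hP_one v v']; exact h_dist_edge hadj ⟨zero_le_one, le_rfl⟩ zs
      have aux : ∀ z, eDist (hE z) (hP v v' s) ≤ 1 →
          |aS z x - 2 * Real.log (eDist p (hP v v' s) + 2)| ≤ M + 2 := by
        intro z hz
        have h1 := prof (x.1 - z.1, x.2 - z.2)
        push_cast at h1
        have h2 : |Real.log (eDist (hE x) (hE z) + 2) -
            Real.log (eDist p (hP v v' s) + 2)| ≤ 1 := by
          apply h_log_close (h_eDist_nonneg _ _) (h_eDist_nonneg _ _)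
          · have := h_eDist_tri (hE x) p (hE z)
            have := h_eDist_tri p (hP v v' s) (hE z)
            rw [h_eDist_symm] at hz
            linarith
          · have := h_eDist_tri p (hE x) (hP v v' s)
            have := h_eDist_tri (hE x) (hE z) (hP v v' s)
            rw [h_eDist_symm] at hp
            linarith
        have h3 : |aS z x - 2 * Real.log (eDist (hE x) (hE z) + 2)| ≤ M := h1
        rw [abs_le] at *
        constructor <;> linarith
      have b1 := aux v dv
      have b2 := aux v' dv'
      have b3 := h_conv b1 b2 hs0.le hs1.le
      have e : fV x - (C * Real.log (eDist p (hP v v' s) + 2) + C₁) =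
          K * (aS v x + s * (aS v' x - aS v x) - 2 * Real.log (eDist p (hP v v' s) + 2)) := by
        simp only [hfV, hK]; ring
      rw [e, abs_mul, abs_of_pos hK0]
      have := mul_le_mul_of_nonneg_left b3 hK0.le
      have : 0 ≤ 15 * C * |ρ| + 2 * C := by positivity
      linarith
    · intro p hp
      have d0 := h_eDist_nonneg p (hP v v' s)
      have l0 := Real.log_nonneg (show 1 ≤ eDist p (hP v v' s) + 2 by linarith)
      have l1 : Real.log (eDist p (hP v v' s) + 2) ≤ 2 := by
        have := Real.log_le_sub_one_of_pos (show 0 < eDist p (hP v v' s) + 2 by linarith)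
        linarith
      have ss : s * (1 - s) ≤ 1 := by nlinarith
      have ss0 : 0 ≤ s * (1 - s) := by positivity
      have b1 : |(-30 * K * ρ * s * (1 - s))| ≤ 15 * C * |ρ| := by
        rw [show -30 * K * ρ * s * (1 - s) = -(15 * C * (s * (1 - s)) * ρ) by rw [hK]; ring,
          abs_neg, abs_mul, abs_of_nonneg (by positivity)]
        apply mul_le_mul_of_nonneg_right _ (abs_nonneg _)
        nlinarith
      have b2 : C * Real.log (eDist p (hP v v' s) + 2) ≤ C * 2 :=
        mul_le_mul_of_nonneg_left l1 hC.le
      have b3 : 0 ≤ C * Real.log (eDist p (hP v v' s) + 2) := by positivity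
      have b4 : 0 ≤ K * (M + 2) := by positivity
      rw [abs_le] at b1 ⊢
      simp only [hfw]
      constructor <;> linarith [b1.1, b1.2]
  refine ⟨fV, fw, ?_, ?_, ?_, hprof, ?_⟩
  · intro u _ _ h1 h2
    rw [hsum, ← Sh v u h1, ← Sh v' u h2]
    simp only [hfV]; ring
  · intro _
    rw [h_sum_sdiff _ hadj, hsum, Sz, ← Sh v' v hne, Sadj _ _ hadj', fv, fv', hfw]
    field_simp
    ring
  · intro _
    rw [h_sum_sdiff _ hadj', hsum, Sz, ← Sh v v' hne.symm, Sadj _ _ hadj, fv, fv', hfw]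
    field_simp
    ring
  · intro hLC x y b t hx hy hxy ht
    have h := hprof x y b t hx hy hxy ht
    have d0 := h_eDist_nonneg (embPt x y b t) (embPt v v' true (4 * s))
    have l0 := Real.log_nonneg
      (show 1 ≤ eDist (embPt x y b t) (embPt v v' true (4 * s)) + 2 by linarith)
    have b3 : 0 ≤ C * Real.log (eDist (embPt x y b t) (embPt v v' true (4 * s)) + 2) := by
      positivity
    rw [abs_le] at h
    linarith [h.1]

end
end
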